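/- arXiv:1601.07456 — 10 statements merged into one kernel-verified Lean document; each statement's English description precedes it below -/
import Mathlib

section
/- For every real number p ≥ 2 and all real numbers a, b ≥ 0, one has |a − b|^p ≤ (a − b)(a^{p−1} − b^{p−1}). -/
/-- Superadditivity of `x ↦ x ^ q` for `q ≥ 1`, in subtractive form. -/
theorem Real.sub_rpow_le_rpow_sub {q a b : ℝ} (hq : 1 ≤ q) (hb : 0 ≤ b) (hab : b ≤ a) :
    (a - b) ^ q ≤ a ^ q - b ^ q := by
  have h := NNReal.add_rpow_le_rpow_add ⟨a - b, sub_nonneg.2 hab⟩ ⟨b, hb⟩ hq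
  have h' : (a - b) ^ q + b ^ q ≤ (a - b + b) ^ q := by exact_mod_cast h
  rw [sub_add_cancel] at h'
  linarith

/-- For every real `p ≥ 2` and nonnegative reals `a, b`,
`|a - b| ^ p ≤ (a - b) * (a ^ (p - 1) - b ^ (p - 1))`, where powers are real powers. -/
theorem stmt_0 (p a b : ℝ) (hp : 2 ≤ p) (ha : 0 ≤ a) (hb : 0 ≤ b) :
    |a - b| ^ p ≤ (a - b) * (a ^ (p - 1) - b ^ (p - 1)) := by
  wlog hab : b ≤ a generalizing a b
  · have h := this b a hb ha (le_of_not_ge hab)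
    rw [abs_sub_comm] at h
    linarith
  have hd : 0 ≤ a - b := sub_nonneg.2 hab
  calc |a - b| ^ p = (a - b) * (a - b) ^ (p - 1) := by
        rw [abs_of_nonneg hd, ← Real.rpow_one_add' hd (by linarith), add_sub_cancel]
    _ ≤ (a - b) * (a ^ (p - 1) - b ^ (p - 1)) :=
        mul_le_mul_of_nonneg_left (Real.sub_rpow_le_rpow_sub (by linarith) hb hab) hd
end

section
/- Let n ≥ 1, let A and B be positive semidefinite n×n complex matrices, and let p ≥ 2 be a real number. Then Re(trace(|A − B|^p)) ≤ Re(trace((A − B) * (A^{p−1} − B^{p−1}))). -/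
open ComplexOrder

namespace Matrix
variable {ι : Type*} {A B D M N Q X Z W : Matrix ι ι ℂ}

lemma PosSemidef.posDef_smul_one_add [DecidableEq ι] (hA : A.PosSemidef) {s : ℝ} (hs : 0 < s) :
    ((s : ℂ) • (1 : Matrix ι ι ℂ) + A).PosDef :=
  (PosDef.one.smul (by exact_mod_cast hs)).add_posSemidef hA

variable [Fintype ι]

lemma PosSemidef.trace_re_nonneg (hA : A.PosSemidef) : 0 ≤ A.trace.re :=
  (Complex.nonneg_iff.1 hA.trace_nonneg).1

lemma PosSemidef.hermitian_conj (hA : A.PosSemidef) (hX : X.IsHermitian) :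
    (X * A * X).PosSemidef := by
  simpa [hX.eq] using hA.mul_mul_conjTranspose_same X

variable [DecidableEq ι]

lemma PosDef.mul_inv_self (hM : M.PosDef) : M * M⁻¹ = 1 :=
  Matrix.mul_nonsing_inv _ ((isUnit_iff_isUnit_det _).1 hM.isUnit)

lemma PosDef.inv_mul_self (hM : M.PosDef) : M⁻¹ * M = 1 :=
  Matrix.nonsing_inv_mul _ ((isUnit_iff_isUnit_det _).1 hM.isUnit)

/-- The tangent-plane bound for the operator convex map `M ↦ M⁻¹`. -/
lemma PosDef.inv_sub_posSemidef (hM : M.PosDef) (hX : X.IsHermitian) :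
    (M⁻¹ - (X + X - X * M * X)).PosSemidef := by
  have h := hM.inv.posSemidef.mul_mul_conjTranspose_same (1 - X * M)
  have e : (1 - X * M) * M⁻¹ * (1 - X * M)ᴴ = M⁻¹ - (X + X - X * M * X) := by
    rw [conjTranspose_sub, conjTranspose_mul, hX.eq, hM.isHermitian.eq, conjTranspose_one]
    have h1 := hM.mul_inv_self
    have h2 := hM.inv_mul_self
    calc (1 - X * M) * M⁻¹ * (1 - M * X)
        = M⁻¹ - X * (M * M⁻¹) - (M⁻¹ * M) * X + X * (M * M⁻¹) * M * X := by noncomm_ring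
      _ = _ := by rw [h1, h2]; noncomm_ring
  rwa [e] at h

lemma PosDef.inv_antitone (hM : M.PosDef) (hN : N.PosDef) (h : (N - M).PosSemidef) :
    (M⁻¹ - N⁻¹).PosSemidef := by
  have h1 := hM.inv_sub_posSemidef hN.inv.isHermitian
  have h2 := h.hermitian_conj hN.inv.isHermitian
  have e : M⁻¹ - N⁻¹ = (M⁻¹ - (N⁻¹ + N⁻¹ - N⁻¹ * M * N⁻¹)) + N⁻¹ * (N - M) * N⁻¹ := by
    have : N⁻¹ * (N - M) * N⁻¹ = N⁻¹ * (N * N⁻¹) - N⁻¹ * M * N⁻¹ := by noncomm_ring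
    rw [this, hN.mul_inv_self]; noncomm_ring
  rw [e]; exact h1.add h2

lemma PosSemidef.trace_mul_re_nonneg (hA : A.PosSemidef) (hB : B.PosSemidef) :
    0 ≤ (A * B).trace.re := by
  obtain ⟨C, rfl⟩ : ∃ C : Matrix ι ι ℂ, A = Cᴴ * C := by
    open scoped MatrixOrder in
    exact CStarAlgebra.nonneg_iff_eq_star_mul_self.mp hA.nonneg
  rw [Matrix.mul_assoc, trace_mul_comm]
  exact (hB.mul_mul_conjTranspose_same C).trace_re_nonneg

lemma PosSemidef.trace_add_inv_mono (hZ : Z.PosSemidef) (hW : W.PosSemidef)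
    (h : (W - Z).PosSemidef) :
    (Z + (1 + Z)⁻¹).trace.re ≤ (W + (1 + W)⁻¹).trace.re := by
  have hN : (1 + Z).PosDef := PosDef.one.add_posSemidef hZ
  have hM : (1 + W).PosDef := PosDef.one.add_posSemidef hW
  have h1 := (hM.inv_sub_posSemidef hN.inv.isHermitian).trace_re_nonneg
  set R := (1 + Z)⁻¹ with hR
  have hRH : R.IsHermitian := hN.inv.isHermitian
  have hNR : (1 + Z) * R = 1 := hN.mul_inv_self
  have hRN : R * (1 + Z) = 1 := hN.inv_mul_self
  have h2 : (1 - R * R).PosSemidef := by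
    have e : 1 - R * R = R * (Z + Z + Z * Z) * R := by
      calc 1 - R * R = (R * (1 + Z)) * ((1 + Z) * R) - R * R := by rw [hNR, hRN, one_mul]
        _ = _ := by noncomm_ring
    rw [e]
    refine ((hZ.add hZ).add ?_).hermitian_conj hRH
    simpa [pow_two] using hZ.pow 2
  have h3 := h2.trace_mul_re_nonneg h
  have e1 : ((1 - R * R) * (W - Z)).trace = (W - Z).trace - (R * (W - Z) * R).trace := by
    rw [trace_mul_comm (R * (W - Z)) R, ← trace_sub]; congr 1; noncomm_ring
  have e2 : R * (1 + W) * R = R + R * (W - Z) * R := by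
    calc R * (1 + W) * R = (R * (1 + Z)) * R + R * (W - Z) * R := by noncomm_ring
      _ = _ := by rw [hRN, one_mul]
  rw [e2] at h1
  rw [e1] at h3
  simp only [trace_add, trace_sub, Complex.add_re, Complex.sub_re] at h1 h3 ⊢
  linarith

lemma trace_mul_inv_sub_inv_le {s : ℝ} (hs : 0 < s) (hA : A.PosSemidef) (hB : B.PosSemidef)
    (hQ : Q.IsHermitian) (h : (B + Q * Q - A).PosSemidef) :
    (Q * Q * (((s : ℂ) • (1 : Matrix ι ι ℂ) + B)⁻¹ - ((s : ℂ) • (1 : Matrix ι ι ℂ) + A)⁻¹)).trace.re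
      ≤ ((s⁻¹ : ℂ) • (Q * Q) - 1 + (1 + (s⁻¹ : ℂ) • (Q * Q))⁻¹).trace.re := by
  have hP : (Q * Q).PosSemidef := by simpa [hQ.eq] using posSemidef_conjTranspose_mul_self Q
  have hM := hB.posDef_smul_one_add hs
  have hN := hA.posDef_smul_one_add hs
  have hL := (hB.add hP).posDef_smul_one_add hs
  have h1 := hN.inv_antitone hL (by convert h using 1; abel)
  have h2 := hP.trace_mul_re_nonneg h1
  set M := (s : ℂ) • (1 : Matrix ι ι ℂ) + B with hMdef
  set R := M⁻¹ with hR
  have hRM : M * R = 1 := hM.mul_inv_self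
  have hZ : (Q * R * Q).PosSemidef := hM.inv.posSemidef.hermitian_conj hQ
  set Z := Q * R * Q with hZdef
  have hT := (PosDef.one.add_posSemidef hZ).mul_inv_self
  set T := (1 + Z)⁻¹ with hTdef
  have hZT : Z * T = 1 - T := by rw [← hT]; noncomm_ring
  have hinv : ((s : ℂ) • (1 : Matrix ι ι ℂ) + (B + Q * Q))⁻¹ = R - R * Q * T * Q * R := by
    apply inv_eq_right_inv
    rw [← add_assoc, ← hMdef]
    calc (M + Q * Q) * (R - R * Q * T * Q * R)
        = M * R - (M * R) * Q * T * Q * R + Q * Q * R - Q * (Q * R * Q * T) * Q * R := by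
          noncomm_ring
      _ = 1 := by rw [hRM, ← hZdef, hZT]; noncomm_ring
  have hsR : ((s⁻¹ : ℂ) • (1 : Matrix ι ι ℂ) - R).PosSemidef := by
    have hs1 : ((s : ℂ) • (1 : Matrix ι ι ℂ)).PosDef := PosDef.one.smul (by exact_mod_cast hs)
    have := hs1.inv_antitone hM (by simpa [hMdef] using hB)
    have e : ((s : ℂ) • (1 : Matrix ι ι ℂ))⁻¹ = (s⁻¹ : ℂ) • (1 : Matrix ι ι ℂ) := by
      apply inv_eq_right_inv
      have : (s : ℂ) ≠ 0 := by exact_mod_cast hs.ne'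
      rw [smul_mul_smul_comm, mul_inv_cancel₀ this, one_smul, mul_one]
    rwa [e] at this
  have hW : ((s⁻¹ : ℂ) • (Q * Q)).PosSemidef := by
    exact hP.smul (by exact_mod_cast inv_nonneg.2 hs.le)
  have hmono := hZ.trace_add_inv_mono hW (by
    have := hsR.hermitian_conj hQ
    convert this using 1
    rw [mul_sub, sub_mul]; simp [hZdef])
  have e3 : (Q * Q * (R - (R - R * Q * T * Q * R))).trace = (Z - 1 + T).trace := by
    calc (Q * Q * (R - (R - R * Q * T * Q * R))).trace
        = (Q * (Q * R * Q * T * Q * R)).trace := by congr 1; noncomm_ring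
      _ = ((Q * R * Q * T) * (Q * R * Q)).trace := by
          rw [trace_mul_comm]; congr 1; noncomm_ring
      _ = (Z - T * Z).trace := by rw [← hZdef, hZT, sub_mul, one_mul]
      _ = (Z - Z * T).trace := by rw [trace_sub, trace_sub, trace_mul_comm T Z]
      _ = _ := by rw [hZT]; congr 1; abel
  rw [hinv] at h2
  have e4 := congrArg Complex.re e3
  simp only [mul_sub, trace_add, trace_sub, Complex.add_re, Complex.sub_re] at e4 h2 hmono ⊢
  linarith

namespace IsHermitian

lemma cfc_continuousOn (A : Matrix ι ι ℂ) (f : ℝ → ℝ) : ContinuousOn f (spectrum ℝ A) :=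
  (finite_real_spectrum (A := A)).continuousOn f

lemma cfc_mul_cfc (A : Matrix ι ι ℂ) (f g : ℝ → ℝ) :
    cfc f A * cfc g A = cfc (fun t => f t * g t) A :=
  (cfc_mul f g A (cfc_continuousOn A f) (cfc_continuousOn A g)).symm

lemma isHermitian_cfc (A : Matrix ι ι ℂ) (f : ℝ → ℝ) : (cfc f A).IsHermitian :=
  cfc_predicate f A

/-- The real part of the `i`-th diagonal entry of `M` in an eigenbasis of `A`. -/
noncomputable def eigenDiag (hA : A.IsHermitian) (M : Matrix ι ι ℂ) (i : ι) : ℝ :=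
  ((star (hA.eigenvectorUnitary : Matrix ι ι ℂ) * M * hA.eigenvectorUnitary) i i).re

/-- The squared modulus of the inner product of two eigenvectors. -/
noncomputable def overlap (hA : A.IsHermitian) (hB : B.IsHermitian) (i j : ι) : ℝ :=
  Complex.normSq ((star (hA.eigenvectorUnitary : Matrix ι ι ℂ) * hB.eigenvectorUnitary) i j)

lemma overlap_nonneg (hA : A.IsHermitian) (hB : B.IsHermitian) (i j : ι) :
    0 ≤ hA.overlap hB i j := Complex.normSq_nonneg _

lemma eigenDiag_sub (hA : A.IsHermitian) (M N : Matrix ι ι ℂ) (i : ι) :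
    hA.eigenDiag (M - N) i = hA.eigenDiag M i - hA.eigenDiag N i := by
  simp [eigenDiag, mul_sub, sub_mul]

lemma eigenDiag_nonneg (hA : A.IsHermitian) (hM : M.PosSemidef) (i : ι) :
    0 ≤ hA.eigenDiag M i :=
  (Complex.nonneg_iff.1 ((hM.conjTranspose_mul_mul_same
    (hA.eigenvectorUnitary : Matrix ι ι ℂ)).diag_nonneg (i := i))).1

lemma cfc_eq_unitary (hA : A.IsHermitian) (f : ℝ → ℝ) :
    cfc f A = (hA.eigenvectorUnitary : Matrix ι ι ℂ) *
      diagonal (fun i => (f (hA.eigenvalues i) : ℂ)) *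
        star (hA.eigenvectorUnitary : Matrix ι ι ℂ) := by
  rw [hA.cfc_eq, IsHermitian.cfc, Unitary.conjStarAlgAut_apply]
  rfl

lemma trace_mul_cfc_re (hA : A.IsHermitian) (M : Matrix ι ι ℂ) (f : ℝ → ℝ) :
    (M * cfc f A).trace.re = ∑ i, f (hA.eigenvalues i) * hA.eigenDiag M i := by
  rw [hA.cfc_eq_unitary, ← mul_assoc, trace_mul_comm, ← mul_assoc, ← mul_assoc]
  simp [trace, eigenDiag, mul_comm]

lemma trace_cfc_re (hA : A.IsHermitian) (f : ℝ → ℝ) :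
    (cfc f A).trace.re = ∑ i, f (hA.eigenvalues i) := by
  have := hA.trace_mul_cfc_re 1 f
  simpa [eigenDiag] using this

lemma eigenDiag_cfc (hA : A.IsHermitian) (hB : B.IsHermitian) (f : ℝ → ℝ) (i : ι) :
    hA.eigenDiag (cfc f B) i = ∑ j, f (hB.eigenvalues j) * hA.overlap hB i j := by
  set U := (hA.eigenvectorUnitary : Matrix ι ι ℂ) with hU
  set V := (hB.eigenvectorUnitary : Matrix ι ι ℂ) with hV
  have e : star U * (V * diagonal (fun i => (f (hB.eigenvalues i) : ℂ)) * star V) * U =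
      (star U * V) * diagonal (fun i => (f (hB.eigenvalues i) : ℂ)) * star (star U * V) := by
    rw [star_mul, star_star]; noncomm_ring
  rw [eigenDiag, hB.cfc_eq_unitary, ← hU, ← hV, e, mul_apply, Complex.re_sum]
  refine Finset.sum_congr rfl fun j _ => ?_
  rw [mul_diagonal, star_apply, mul_right_comm, RCLike.star_def, Complex.mul_conj, overlap,
    mul_comm]
  norm_cast

lemma eigenDiag_self (hA : A.IsHermitian) (i : ι) : hA.eigenDiag A i = hA.eigenvalues i := by
  have h := hA.eigenDiag_cfc hA id i
  rw [cfc_id ℝ A hA.isSelfAdjoint] at h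
  simpa [overlap, one_apply, apply_ite Complex.normSq] using h

lemma sum_overlap (hA : A.IsHermitian) (hB : B.IsHermitian) (i : ι) :
    ∑ j, hA.overlap hB i j = 1 := by
  have h := hA.eigenDiag_cfc hB (fun _ => 1) i
  rw [cfc_const_one ℝ B hB.isSelfAdjoint] at h
  simpa [eigenDiag] using h.symm

lemma trace_cfc_mul_cfc_re (hA : A.IsHermitian) (hB : B.IsHermitian) (f g : ℝ → ℝ) :
    (cfc f A * cfc g B).trace.re =
      ∑ i, ∑ j, f (hA.eigenvalues i) * g (hB.eigenvalues j) * hA.overlap hB i j := by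
  rw [trace_mul_comm, hA.trace_mul_cfc_re]
  simp only [hA.eigenDiag_cfc hB, Finset.mul_sum, mul_assoc]

end IsHermitian

lemma PosSemidef.cfc_inv_add (hA : A.PosSemidef) {s : ℝ} (hs : 0 < s) :
    cfc (fun t : ℝ => (s + t)⁻¹) A = ((s : ℂ) • (1 : Matrix ι ι ℂ) + A)⁻¹ := by
  have hAs : IsSelfAdjoint A := hA.isHermitian
  symm
  apply inv_eq_right_inv
  have e : (s : ℂ) • (1 : Matrix ι ι ℂ) + A = cfc (fun t : ℝ => s + t) A := by
    rw [cfc_const_add s (fun t => t) A, cfc_id' ℝ A]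
    congr 1
    simp [Algebra.algebraMap_eq_smul_one]
  rw [e, IsHermitian.cfc_mul_cfc]
  rw [← cfc_const_one ℝ A]
  refine cfc_congr fun t ht => mul_inv_cancel₀ ?_
  rw [hA.isHermitian.spectrum_real_eq_range_eigenvalues] at ht
  obtain ⟨i, rfl⟩ := ht
  have := hA.eigenvalues_nonneg i
  positivity

lemma posSemidef_cfc (A : Matrix ι ι ℂ) {f : ℝ → ℝ} (hf : ∀ t, 0 ≤ f t) : (cfc f A).PosSemidef := by
  open scoped MatrixOrder in
  exact nonneg_iff_posSemidef.1 (cfc_nonneg fun t _ => hf t)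

/-- One-sided resolvent estimate, where `u` dominates `A - B` spectrally. -/
lemma IsHermitian.trace_cfc_mul_inv_sub_inv_le (hD : D.IsHermitian) {s : ℝ} (hs : 0 < s)
    (hA : A.PosSemidef) (hB : B.PosSemidef) {u : ℝ → ℝ} (hu : ∀ t, 0 ≤ u t)
    (h : (B + cfc u D - A).PosSemidef) :
    (cfc u D * (cfc (fun t : ℝ => (s + t)⁻¹) B - cfc (fun t : ℝ => (s + t)⁻¹) A)).trace.re ≤
      ∑ i, (u (hD.eigenvalues i) / s - 1 + (1 + u (hD.eigenvalues i) / s)⁻¹) := by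
  have hDs : IsSelfAdjoint D := hD
  have hQ : cfc (fun t => √(u t)) D * cfc (fun t => √(u t)) D = cfc u D := by
    rw [IsHermitian.cfc_mul_cfc]; simp [Real.mul_self_sqrt (hu _)]
  have key := trace_mul_inv_sub_inv_le hs hA hB
    (IsHermitian.isHermitian_cfc D (fun t => √(u t))) (by rwa [hQ])
  rw [hQ, ← hA.cfc_inv_add hs, ← hB.cfc_inv_add hs] at key
  have hW : (s⁻¹ : ℂ) • cfc u D = cfc (fun t => s⁻¹ * u t) D := by
    rw [cfc_const_mul s⁻¹ u D (IsHermitian.cfc_continuousOn _ _)]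
    ext i j; simp
  have hWp : (cfc (fun t => s⁻¹ * u t) D).PosSemidef :=
    posSemidef_cfc D fun t => mul_nonneg (inv_nonneg.2 hs.le) (hu t)
  have hI : (1 + cfc (fun t => s⁻¹ * u t) D)⁻¹ = cfc (fun t => (1 + s⁻¹ * u t)⁻¹) D := by
    apply inv_eq_right_inv
    rw [← cfc_const_one ℝ D, ← cfc_add _ _ _ (IsHermitian.cfc_continuousOn _ _)
      (IsHermitian.cfc_continuousOn _ _), IsHermitian.cfc_mul_cfc]
    refine cfc_congr fun t _ => mul_inv_cancel₀ ?_
    have := hu t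
    positivity
  rw [hW, hI] at key
  refine key.trans (le_of_eq ?_)
  rw [trace_add, trace_sub, Complex.add_re, Complex.sub_re, hD.trace_cfc_re, hD.trace_cfc_re]
  simp [Finset.sum_add_distrib, Finset.sum_sub_distrib, div_eq_inv_mul]

open Real in
lemma PosSemidef.sum_rpowIntegrand₁₂_le (hA : A.PosSemidef) (hB : B.PosSemidef)
    (hD : (A - B).IsHermitian) (q : ℝ) {s : ℝ} (hs : 0 < s) :
    ∑ i, |hD.eigenvalues i| * rpowIntegrand₁₂ q s |hD.eigenvalues i| ≤
      ((A - B) * (cfc (rpowIntegrand₁₂ q s) A - cfc (rpowIntegrand₁₂ q s) B)).trace.re := by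
  have hDs : IsSelfAdjoint (A - B) := hD
  set f : ℝ → ℝ := fun t => (s + t)⁻¹
  have hdiff : cfc (fun t : ℝ => max t 0) (A - B) - cfc (fun t : ℝ => max (-t) 0) (A - B) = A - B := by
    conv_rhs => rw [← cfc_id' ℝ (A - B)]
    rw [← cfc_sub _ _ _ (IsHermitian.cfc_continuousOn _ _) (IsHermitian.cfc_continuousOn _ _)]
    refine cfc_congr fun t _ => ?_
    rcases le_total t 0 with h | h <;> simp [h]
  have h1 := hD.trace_cfc_mul_inv_sub_inv_le hs hA hB (u := fun t : ℝ => max t 0)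
    (fun t => le_max_right _ _) (by
      have := posSemidef_cfc (A - B) (f := fun t : ℝ => max (-t) 0) fun t => le_max_right _ _
      convert this using 1
      rw [← sub_eq_zero, ← sub_eq_zero.2 hdiff]; abel)
  have h2 := hD.trace_cfc_mul_inv_sub_inv_le hs hB hA (u := fun t : ℝ => max (-t) 0)
    (fun t => le_max_right _ _) (by
      have := posSemidef_cfc (A - B) (f := fun t : ℝ => max t 0) fun t => le_max_right _ _
      convert this using 1
      rw [← sub_eq_zero, ← sub_eq_zero.2 hdiff.symm]; abel)
  have h3 : ((A - B) * (cfc f B - cfc f A)).trace.re ≤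
      ∑ i, (|hD.eigenvalues i| / s - 1 + (1 + |hD.eigenvalues i| / s)⁻¹) := by
    have e : (A - B) * (cfc f B - cfc f A) =
        cfc (fun t : ℝ => max t 0) (A - B) * (cfc f B - cfc f A) +
          cfc (fun t : ℝ => max (-t) 0) (A - B) * (cfc f A - cfc f B) := by
      conv_lhs => rw [← hdiff]
      noncomm_ring
    rw [e, trace_add, Complex.add_re]
    refine (add_le_add h1 h2).trans (le_of_eq ?_)
    rw [← Finset.sum_add_distrib]
    refine Finset.sum_congr rfl fun i _ => ?_
    rcases le_total (hD.eigenvalues i) 0 with h | h <;> simp [h, abs_of_nonpos, abs_of_nonneg]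
  have hc : ∀ {M : Matrix ι ι ℂ}, M.IsHermitian → cfc (rpowIntegrand₁₂ q s) M =
      (s ^ (q - 1) : ℝ) • (s⁻¹ • M + s • cfc f M - 1) := by
    intro M hM
    have hMs : IsSelfAdjoint M := hM
    have hco := IsHermitian.cfc_continuousOn M
    conv_rhs => rw [← cfc_const_one ℝ M]; enter [2, 1, 1]; rw [← cfc_id' ℝ M]
    rw [← cfc_smul _ _ _ (hco _), ← cfc_smul _ _ _ (hco _), ← cfc_add _ _ _ (hco _) (hco _),
      ← cfc_sub _ _ _ (hco _) (hco _), ← cfc_smul _ _ _ (hco _)]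
    rfl
  have h4 : ((A - B) * (A - B)).trace.re = ∑ i, |hD.eigenvalues i| ^ 2 := by
    have := hD.trace_mul_cfc_re (A - B) id
    rw [cfc_id ℝ (A - B)] at this
    rw [this]
    refine Finset.sum_congr rfl fun i _ => ?_
    rw [hD.eigenDiag_self, sq_abs, id, sq]
  have h5 : (A - B) * (cfc (rpowIntegrand₁₂ q s) A - cfc (rpowIntegrand₁₂ q s) B) =
      (s ^ (q - 1) : ℝ) • (s⁻¹ • ((A - B) * (A - B)) - s • ((A - B) * (cfc f B - cfc f A))) := by
    rw [hc hA.isHermitian, hc hB.isHermitian, ← smul_sub, mul_smul_comm,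
      ← mul_smul_comm s⁻¹ (A - B), ← mul_smul_comm s (A - B), ← mul_sub]
    congr 2
    simp only [smul_sub]
    abel
  rw [h5, trace_smul, trace_sub, trace_smul, trace_smul, Complex.smul_re, Complex.sub_re,
    Complex.smul_re, Complex.smul_re, h4]
  calc ∑ i, |hD.eigenvalues i| * rpowIntegrand₁₂ q s |hD.eigenvalues i|
      = s ^ (q - 1) • (s⁻¹ • ∑ i, |hD.eigenvalues i| ^ 2 -
          s • ∑ i, (|hD.eigenvalues i| / s - 1 + (1 + |hD.eigenvalues i| / s)⁻¹)) := by
        simp only [smul_eq_mul, Finset.mul_sum, ← Finset.sum_sub_distrib]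
        refine Finset.sum_congr rfl fun i _ => ?_
        have := abs_nonneg (hD.eigenvalues i)
        set d := |hD.eigenvalues i|
        have h0 : s + d ≠ 0 := by positivity
        have h1 : (1 + d / s)⁻¹ = s * (s + d)⁻¹ := by field_simp
        rw [h1, rpowIntegrand₁₂]
        field_simp
        ring
    _ ≤ _ := by
        simp only [smul_eq_mul]
        gcongr

open Real MeasureTheory Set in
lemma PosSemidef.sum_abs_rpow_le_of_mem_Ioo (hA : A.PosSemidef) (hB : B.PosSemidef)
    (hD : (A - B).IsHermitian) {q : ℝ} (hq : q ∈ Ioo (1 : ℝ) 2) :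
    ∑ i, |hD.eigenvalues i| * |hD.eigenvalues i| ^ q ≤
      ((A - B) * (cfc (fun t : ℝ => t ^ q) A - cfc (fun t : ℝ => t ^ q) B)).trace.re := by
  obtain ⟨μ, hμ⟩ := exists_measure_rpow_eq_integral_rpowIntegrand₁₂ hq
  have hiA i := hμ _ (hA.eigenvalues_nonneg i)
  have hiB i := hμ _ (hB.eigenvalues_nonneg i)
  have hiD i := hμ _ (abs_nonneg (hD.eigenvalues i))
  have h := setIntegral_mono_on (μ := μ)
    (f := fun s => ∑ i, |hD.eigenvalues i| * rpowIntegrand₁₂ q s |hD.eigenvalues i|)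
    (g := fun s => ∑ i, rpowIntegrand₁₂ q s (hA.isHermitian.eigenvalues i) *
        hA.isHermitian.eigenDiag (A - B) i -
      ∑ i, rpowIntegrand₁₂ q s (hB.isHermitian.eigenvalues i) *
        hB.isHermitian.eigenDiag (A - B) i)
    (integrable_finsetSum _ fun i _ => (hiD i).1.const_mul _)
    ((integrable_finsetSum _ fun i _ => (hiA i).1.mul_const _).sub
      (integrable_finsetSum _ fun i _ => (hiB i).1.mul_const _))
    measurableSet_Ioi (fun s hs => by
      have := hA.sum_rpowIntegrand₁₂_le hB hD q hs
      rwa [mul_sub, trace_sub, Complex.sub_re, hA.isHermitian.trace_mul_cfc_re,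
        hB.isHermitian.trace_mul_cfc_re] at this)
  rw [integral_sub (integrable_finsetSum _ fun i _ => (hiA i).1.mul_const _)
      (integrable_finsetSum _ fun i _ => (hiB i).1.mul_const _),
    integral_finsetSum _ fun i _ => (hiD i).1.const_mul _,
    integral_finsetSum _ fun i _ => (hiA i).1.mul_const _,
    integral_finsetSum _ fun i _ => (hiB i).1.mul_const _] at h
  simp only [integral_const_mul, integral_mul_const, ← (hiA _).2, ← (hiB _).2, ← (hiD _).2] at h
  rwa [mul_sub, trace_sub, Complex.sub_re, hA.isHermitian.trace_mul_cfc_re,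
    hB.isHermitian.trace_mul_cfc_re]

open Real in
lemma _root_.Real.sq_sub_mul_rpow_add_rpow_le {a b q : ℝ} (ha : 0 ≤ a) (hb : 0 ≤ b)
    (hq : 2 ≤ q) :
    (a - b) ^ 2 * (a ^ (q - 1) + b ^ (q - 1)) ≤ (a - b) * (a ^ q - b ^ q) := by
  have e : ∀ {x : ℝ}, 0 ≤ x → x ^ q = x ^ (q - 2) * x ^ 2 ∧ x ^ (q - 1) = x ^ (q - 2) * x := by
    intro x hx
    constructor
    · rw [← rpow_two, ← rpow_add_of_nonneg hx (by linarith) (by norm_num)]; ring_nf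
    · rw [← rpow_add_one' hx (by linarith)]; ring_nf
  have hm : 0 ≤ (a - b) * (a ^ (q - 2) - b ^ (q - 2)) := by
    rcases le_total a b with h | h
    · exact mul_nonneg_of_nonpos_of_nonpos (sub_nonpos.2 h)
        (sub_nonpos.2 (rpow_le_rpow ha h (by linarith)))
    · exact mul_nonneg (sub_nonneg.2 h) (sub_nonneg.2 (rpow_le_rpow hb h (by linarith)))
  rw [(e ha).1, (e hb).1, (e ha).2, (e hb).2]
  nlinarith [mul_nonneg (mul_nonneg ha hb) hm]

lemma PosSemidef.trace_sq_mul_cfc_rpow_le (hA : A.PosSemidef) (hB : B.PosSemidef) {q : ℝ}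
    (hq : 2 ≤ q) :
    ((A - B) * (A - B) * (cfc (fun t : ℝ => t ^ (q - 1)) A +
        cfc (fun t : ℝ => t ^ (q - 1)) B)).trace.re ≤
      ((A - B) * (cfc (fun t : ℝ => t ^ q) A - cfc (fun t : ℝ => t ^ q) B)).trace.re := by
  have hAs := hA.isHermitian.isSelfAdjoint
  have hBs := hB.isHermitian.isSelfAdjoint
  have e (f : ℝ → ℝ) : ((A - B) * (cfc f A - cfc f B)).trace.re =
      ∑ i, ∑ j, (hA.isHermitian.eigenvalues i - hB.isHermitian.eigenvalues j) *
        (f (hA.isHermitian.eigenvalues i) - f (hB.isHermitian.eigenvalues j)) *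
          hA.isHermitian.overlap hB.isHermitian i j := by
    have : ((A - B) * (cfc f A - cfc f B)).trace =
        (cfc (fun t : ℝ => t * f t) A * cfc (fun _ : ℝ => 1) B).trace -
        (cfc (fun t : ℝ => t) A * cfc f B).trace - (cfc f A * cfc (fun t : ℝ => t) B).trace +
        (cfc (fun _ : ℝ => 1) A * cfc (fun t : ℝ => t * f t) B).trace := by
      rw [← IsHermitian.cfc_mul_cfc, ← IsHermitian.cfc_mul_cfc, cfc_const_one ℝ A,
        cfc_const_one ℝ B, cfc_id' ℝ A, cfc_id' ℝ B, mul_one, one_mul,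
        trace_mul_comm (cfc f A) B, ← trace_sub, ← trace_sub, ← trace_add]
      congr 1
      noncomm_ring
    rw [this]
    simp only [Complex.add_re, Complex.sub_re,
      hA.isHermitian.trace_cfc_mul_cfc_re hB.isHermitian, ← Finset.sum_sub_distrib,
      ← Finset.sum_add_distrib]
    refine Finset.sum_congr rfl fun i _ => Finset.sum_congr rfl fun j _ => ?_
    ring
  have e' (f : ℝ → ℝ) : ((A - B) * (A - B) * (cfc f A + cfc f B)).trace.re =
      ∑ i, ∑ j, (hA.isHermitian.eigenvalues i - hB.isHermitian.eigenvalues j) ^ 2 *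
        (f (hA.isHermitian.eigenvalues i) + f (hB.isHermitian.eigenvalues j)) *
          hA.isHermitian.overlap hB.isHermitian i j := by
    have : ((A - B) * (A - B) * (cfc f A + cfc f B)).trace =
        (cfc (fun t : ℝ => t * (t * f t)) A * cfc (fun _ : ℝ => 1) B).trace -
        (cfc (fun t : ℝ => t * f t) A * cfc (fun t : ℝ => t) B).trace -
        (cfc (fun t => f t * t) A * cfc (fun t : ℝ => t) B).trace +
        (cfc f A * cfc (fun t : ℝ => t * t) B).trace +
        (cfc (fun t : ℝ => t * t) A * cfc f B).trace -
        (cfc (fun t : ℝ => t) A * cfc (fun t => f t * t) B).trace -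
        (cfc (fun t : ℝ => t) A * cfc (fun t : ℝ => t * f t) B).trace +
        (cfc (fun _ : ℝ => 1) A * cfc (fun t : ℝ => t * (t * f t)) B).trace := by
      simp only [← IsHermitian.cfc_mul_cfc]
      rw [cfc_const_one ℝ A, cfc_const_one ℝ B, cfc_id' ℝ A, cfc_id' ℝ B, mul_one, one_mul,
        trace_mul_comm (A * cfc f A) B, trace_mul_comm (cfc f A * A) B,
        trace_mul_comm (cfc f A) (B * B)]
      have h1 : (B * (cfc f A * A)).trace = (A * B * cfc f A).trace := by
        rw [← mul_assoc, trace_mul_comm, ← mul_assoc]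
      have h2 : (A * (cfc f B * B)).trace = (B * A * cfc f B).trace := by
        rw [← mul_assoc, trace_mul_comm, ← mul_assoc]
      rw [h1, h2]
      simp only [← trace_sub, ← trace_add]
      congr 1
      noncomm_ring
    rw [this]
    simp only [Complex.add_re, Complex.sub_re,
      hA.isHermitian.trace_cfc_mul_cfc_re hB.isHermitian, ← Finset.sum_sub_distrib,
      ← Finset.sum_add_distrib]
    refine Finset.sum_congr rfl fun i _ => Finset.sum_congr rfl fun j _ => ?_
    ring
  rw [e, e']
  exact Finset.sum_le_sum fun i _ => Finset.sum_le_sum fun j _ => mul_le_mul_of_nonneg_right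
    (Real.sq_sub_mul_rpow_add_rpow_le (hA.eigenvalues_nonneg i) (hB.eigenvalues_nonneg j) hq)
    (IsHermitian.overlap_nonneg _ _ i j)

lemma PosSemidef.eigenDiag_rpow_le (hA : A.PosSemidef) (hD : D.IsHermitian) {r : ℝ}
    (hr : 1 ≤ r) (i : ι) :
    hD.eigenDiag A i ^ r ≤ hD.eigenDiag (cfc (fun t : ℝ => t ^ r) A) i := by
  have h := hD.eigenDiag_cfc hA.isHermitian (fun t : ℝ => t) i
  rw [cfc_id' ℝ A hA.isHermitian.isSelfAdjoint] at h
  rw [h, hD.eigenDiag_cfc hA.isHermitian]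
  simp only [mul_comm _ (hD.overlap hA.isHermitian i _)]
  exact Real.rpow_arith_mean_le_arith_mean_rpow _ _ _
    (fun j _ => IsHermitian.overlap_nonneg _ _ i j) (hD.sum_overlap _ i)
    (fun j _ => hA.eigenvalues_nonneg j) hr

lemma PosSemidef.sum_abs_rpow_le_of_two_le (hA : A.PosSemidef) (hB : B.PosSemidef)
    (hD : (A - B).IsHermitian) {q : ℝ} (hq : 2 ≤ q) :
    ∑ i, |hD.eigenvalues i| * |hD.eigenvalues i| ^ q ≤
      ((A - B) * (cfc (fun t : ℝ => t ^ q) A - cfc (fun t : ℝ => t ^ q) B)).trace.re := by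
  refine le_trans ?_ (hA.trace_sq_mul_cfc_rpow_le hB hq)
  set S := cfc (fun t : ℝ => t ^ (q - 1)) A + cfc (fun t : ℝ => t ^ (q - 1)) B with hS
  have hsq : (A - B) * (A - B) = cfc (fun t : ℝ => t * t) (A - B) := by
    rw [← IsHermitian.cfc_mul_cfc, cfc_id' ℝ (A - B) hD.isSelfAdjoint]
  rw [hsq, trace_mul_comm, hD.trace_mul_cfc_re]
  refine Finset.sum_le_sum fun i _ => ?_
  have hadd : hD.eigenDiag S i = hD.eigenDiag (cfc (fun t : ℝ => t ^ (q - 1)) A) i +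
      hD.eigenDiag (cfc (fun t : ℝ => t ^ (q - 1)) B) i := by
    simp [hS, IsHermitian.eigenDiag, mul_add, add_mul]
  have hJA := hA.eigenDiag_rpow_le hD (r := q - 1) (by linarith) i
  have hJB := hB.eigenDiag_rpow_le hD (r := q - 1) (by linarith) i
  have hA0 := hD.eigenDiag_nonneg hA i
  have hB0 := hD.eigenDiag_nonneg hB i
  have hd := hD.eigenDiag_sub A B i
  rw [hD.eigenDiag_self] at hd
  have key : |hD.eigenvalues i| ^ (q - 1) ≤ hD.eigenDiag S i := by
    have hA1 := Real.rpow_nonneg hA0 (q - 1)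
    have hB1 := Real.rpow_nonneg hB0 (q - 1)
    rcases le_total (hD.eigenvalues i) 0 with h | h
    · have := Real.rpow_le_rpow (abs_nonneg (hD.eigenvalues i))
        (by rw [abs_of_nonpos h]; linarith : _ ≤ hD.eigenDiag B i) (by linarith : 0 ≤ q - 1)
      linarith
    · have := Real.rpow_le_rpow (abs_nonneg (hD.eigenvalues i))
        (by rw [abs_of_nonneg h]; linarith : _ ≤ hD.eigenDiag A i) (by linarith : 0 ≤ q - 1)
      linarith
  have e : |hD.eigenvalues i| ^ q = |hD.eigenvalues i| ^ (q - 1) * |hD.eigenvalues i| := by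
    rw [← Real.rpow_add_one' (abs_nonneg _) (by linarith)]; ring_nf
  calc |hD.eigenvalues i| * |hD.eigenvalues i| ^ q
      = hD.eigenvalues i * hD.eigenvalues i * |hD.eigenvalues i| ^ (q - 1) := by
        rw [e, ← abs_mul_abs_self (hD.eigenvalues i)]; ring
    _ ≤ _ := mul_le_mul_of_nonneg_left key (mul_self_nonneg _)

lemma PosSemidef.sum_abs_rpow_le (hA : A.PosSemidef) (hB : B.PosSemidef)
    (hD : (A - B).IsHermitian) {q : ℝ} (hq : 1 ≤ q) :
    ∑ i, |hD.eigenvalues i| * |hD.eigenvalues i| ^ q ≤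
      ((A - B) * (cfc (fun t : ℝ => t ^ q) A - cfc (fun t : ℝ => t ^ q) B)).trace.re := by
  rcases le_or_gt 2 q with h2 | h2
  · exact hA.sum_abs_rpow_le_of_two_le hB hD h2
  rcases hq.eq_or_lt with rfl | h1
  · have h := hD.trace_mul_cfc_re (A - B) (fun t : ℝ => t)
    simp only [Real.rpow_one]
    rw [cfc_id' ℝ (A - B) hD.isSelfAdjoint] at h
    rw [cfc_id' ℝ A hA.isHermitian.isSelfAdjoint, cfc_id' ℝ B hB.isHermitian.isSelfAdjoint, h]
    simp [hD.eigenDiag_self]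
  · exact hA.sum_abs_rpow_le_of_mem_Ioo hB hD ⟨h1, h2⟩

end Matrix

/-- For `n ≥ 1`, positive semidefinite `n × n` complex matrices `A, B` and a real `p ≥ 2`,
`Re (trace |A - B|^p) ≤ Re (trace ((A - B) * (A^(p-1) - B^(p-1))))`, where `|X|^p` and the
real powers of `A` and `B` are given by the continuous functional calculus. -/
theorem stmt_3 (n : ℕ) (hn : 1 ≤ n) (A B : Matrix (Fin n) (Fin n) ℂ)
    (hA : A.PosSemidef) (hB : B.PosSemidef) (p : ℝ) (hp : 2 ≤ p) :
    (Matrix.trace (cfc (fun t : ℝ => |t| ^ p) (A - B))).re ≤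
      (Matrix.trace ((A - B) *
        (cfc (fun t : ℝ => t ^ (p - 1)) A - cfc (fun t : ℝ => t ^ (p - 1)) B))).re := by
  have hD : (A - B).IsHermitian := hA.isHermitian.sub hB.isHermitian
  rw [hD.trace_cfc_re]
  convert hA.sum_abs_rpow_le hB hD (q := p - 1) (by linarith) using 3 with i
  rw [mul_comm, ← Real.rpow_add_one' (abs_nonneg _) (by linarith)]
  ring_nf
end

section
/- Let n ≥ 1, let A and B be positive semidefinite n×n complex matrices, and let m ≥ 2 be a natural number. Then Re(trace(|A − B|^m)) ≤ Re(trace((A − B) * (A^{m−1} − B^{m−1}))), where A^{m−1} and B^{m−1} are ordinary matrix powers. -/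
open ComplexOrder

open scoped MatrixOrder

namespace Matrix

variable {ι : Type*} [Fintype ι] [DecidableEq ι]

theorem trace_conjStarAlgAut (U : unitary (Matrix ι ι ℂ)) (X : Matrix ι ι ℂ) :
    (Unitary.conjStarAlgAut ℂ _ U X).trace = X.trace := by
  rw [Unitary.conjStarAlgAut_apply, trace_mul_cycle, Unitary.coe_star_mul_self, one_mul]

theorem PosSemidef.conjStarAlgAut {X : Matrix ι ι ℂ} (hX : X.PosSemidef)
    (U : unitary (Matrix ι ι ℂ)) : (Unitary.conjStarAlgAut ℂ _ U X).PosSemidef := by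
  rw [Unitary.conjStarAlgAut_apply]
  exact hX.mul_mul_conjTranspose_same _

theorem IsHermitian.trace_cfc {D : Matrix ι ι ℂ} (hD : D.IsHermitian) (f : ℝ → ℝ) :
    (cfc f D).trace = ∑ i, (f (hD.eigenvalues i) : ℂ) := by
  rw [hD.cfc_eq, IsHermitian.cfc, trace_conjStarAlgAut, trace_diagonal]
  rfl

theorem PosSemidef.trace_mul_re_nonneg_s4 {P Q : Matrix ι ι ℂ} (hP : P.PosSemidef)
    (hQ : Q.PosSemidef) : 0 ≤ (P * Q).trace.re := by
  obtain ⟨R, rfl⟩ := CStarAlgebra.nonneg_iff_eq_star_mul_self.mp hQ.nonneg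
  rw [← mul_assoc, trace_mul_comm, ← mul_assoc]
  exact (Complex.nonneg_iff.mp (hP.mul_mul_conjTranspose_same R).trace_nonneg).1

/-- Jensen's inequality for the diagonal entries of powers of a positive semidefinite matrix. -/
theorem PosSemidef.diag_re_pow_le {M : Matrix ι ι ℂ} (hM : M.PosSemidef) (q : ℕ) (k : ι) :
    (M k k).re ^ q ≤ ((M ^ q) k k).re := by
  set U := hM.isHermitian.eigenvectorUnitary
  set l := hM.isHermitian.eigenvalues with hl
  have entry (r : ℕ) : ((M ^ r) k k).re = ∑ i, Complex.normSq (U.1 k i) * l i ^ r := by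
    have h : M ^ r = Unitary.conjStarAlgAut ℂ _ U (diagonal fun i => ((l i ^ r : ℝ) : ℂ)) := by
      conv_lhs => rw [hM.isHermitian.spectral_theorem, ← map_pow, diagonal_pow]
      congr 2
      ext i
      simp [hl]
    rw [h, Unitary.conjStarAlgAut_apply, mul_apply, Complex.re_sum]
    refine Finset.sum_congr rfl fun i _ => ?_
    rw [mul_diagonal, star_apply, mul_right_comm, RCLike.star_def, Complex.mul_conj,
      ← Complex.ofReal_mul, Complex.ofReal_re]
  have hw : ∑ i, Complex.normSq (U.1 k i) = 1 := by simpa using (entry 0).symm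
  have h1 := entry 1
  simp only [pow_one] at h1
  rw [h1, entry q]
  exact Real.pow_arith_mean_le_arith_mean_pow _ _ _ (fun i _ => Complex.normSq_nonneg _) hw
    (fun i _ => hM.eigenvalues_nonneg i) q

theorem trace_sub_sq_mul_pow_le {A B : Matrix ι ι ℂ} (hA : A.PosSemidef) (hB : B.PosSemidef)
    (p k : ℕ) :
    ((A - B) * (A - B) * B ^ (p + k)).trace.re ≤
      ((A - B) * (A ^ (p + 1) - B ^ (p + 1)) * B ^ k).trace.re := by
  induction p generalizing k with
  | zero => simp
  | succ p ih =>
    have hD : (A - B)ᴴ = A - B := (hA.isHermitian.sub hB.isHermitian).eq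
    have key : (A - B) * (A ^ (p + 2) - B ^ (p + 2)) * B ^ k =
        (A - B) * A ^ (p + 1) * (A - B) * B ^ k +
          (A - B) * (A ^ (p + 1) - B ^ (p + 1)) * B ^ (k + 1) := by
      rw [pow_succ A (p + 1), pow_succ B (p + 1), pow_succ' B k]
      noncomm_ring
    have hpos : 0 ≤ ((A - B) * A ^ (p + 1) * (A - B) * B ^ k).trace.re := by
      refine PosSemidef.trace_mul_re_nonneg_s4 ?_ (hB.pow k)
      simpa only [hD] using (hA.pow (p + 1)).conjTranspose_mul_mul_same (A - B)
    rw [key, trace_add, Complex.add_re, add_right_comm p 1 k, add_assoc p k 1]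
    linarith [ih (k + 1)]

theorem trace_sub_mul_pow_sub_pow_ge {A B : Matrix ι ι ℂ} (hA : A.PosSemidef)
    (hB : B.PosSemidef) (r : ℕ) :
    ((A - B) * (A - B) * A ^ (r + 1)).trace.re + ((A - B) * (A - B) * B ^ (r + 1)).trace.re ≤
      ((A - B) * (A ^ (r + 2) - B ^ (r + 2))).trace.re := by
  have key : (A - B) * (A ^ (r + 2) - B ^ (r + 2)) =
      (A - B) * A ^ (r + 1) * (A - B) +
        (A - B) * (A ^ (r + 1) - B ^ (r + 1)) * B ^ 1 := by
    rw [pow_succ A (r + 1), pow_succ B (r + 1), pow_one]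
    noncomm_ring
  rw [key, trace_add, Complex.add_re, trace_mul_cycle (A - B) (A ^ (r + 1)) (A - B)]
  linarith [trace_sub_sq_mul_pow_le hA hB r 1]

theorem trace_diagonal_sq_mul_re (d : ι → ℝ) (X : Matrix ι ι ℂ) :
    (diagonal (fun i => (d i : ℂ)) * diagonal (fun i => (d i : ℂ)) * X).trace.re =
      ∑ i, d i ^ 2 * (X i i).re := by
  rw [diagonal_mul_diagonal, trace, Complex.re_sum]
  refine Finset.sum_congr rfl fun i _ => ?_
  rw [diag_apply, diagonal_mul, ← Complex.ofReal_mul, Complex.re_ofReal_mul, sq]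

theorem sum_abs_pow_le_of_sub_eq_diagonal {A B : Matrix ι ι ℂ} (hA : A.PosSemidef)
    (hB : B.PosSemidef) {d : ι → ℝ} (hd : A - B = diagonal fun i => (d i : ℂ)) (r : ℕ) :
    ∑ i, |d i| ^ (r + 3) ≤ ((A - B) * (A ^ (r + 2) - B ^ (r + 2))).trace.re := by
  refine le_trans ?_ (trace_sub_mul_pow_sub_pow_ge hA hB r)
  rw [hd, trace_diagonal_sq_mul_re, trace_diagonal_sq_mul_re, ← Finset.sum_add_distrib]
  refine Finset.sum_le_sum fun i _ => ?_
  have hAi : 0 ≤ (A i i).re := (Complex.nonneg_iff.mp hA.diag_nonneg).1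
  have hBi : 0 ≤ (B i i).re := (Complex.nonneg_iff.mp hB.diag_nonneg).1
  have hdi : (A i i).re - (B i i).re = d i := by
    simpa using congrArg (fun X : Matrix ι ι ℂ => (X i i).re) hd
  have hpow : |d i| ^ (r + 1) ≤ (A i i).re ^ (r + 1) + (B i i).re ^ (r + 1) := by
    rcases abs_cases (d i) with ⟨h, h0⟩ | ⟨h, h0⟩ <;> rw [h]
    · have := pow_le_pow_left₀ h0 (by linarith : d i ≤ (A i i).re) (r + 1)
      linarith [pow_nonneg hBi (r + 1)]
    · have := pow_le_pow_left₀ (by linarith) (by linarith : -d i ≤ (B i i).re) (r + 1)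
      linarith [pow_nonneg hAi (r + 1)]
  calc |d i| ^ (r + 3) = d i ^ 2 * |d i| ^ (r + 1) := by rw [← sq_abs]; ring
    _ ≤ d i ^ 2 * (((A ^ (r + 1)) i i).re + ((B ^ (r + 1)) i i).re) := by
      gcongr
      linarith [hA.diag_re_pow_le (r + 1) i, hB.diag_re_pow_le (r + 1) i]
    _ = _ := by ring

end Matrix

/-- For `n ≥ 1`, positive semidefinite `n × n` complex matrices `A, B` and a natural
number `m ≥ 2`, `Re (trace |A - B|^m) ≤ Re (trace ((A - B) * (A^(m-1) - B^(m-1))))`,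
where `|X|^m` is given by the continuous functional calculus and `A^(m-1)`, `B^(m-1)`
are ordinary matrix powers. -/
theorem stmt_4 (n : ℕ) (hn : 1 ≤ n) (A B : Matrix (Fin n) (Fin n) ℂ)
    (hA : A.PosSemidef) (hB : B.PosSemidef) (m : ℕ) (hm : 2 ≤ m) :
    (Matrix.trace (cfc (fun t : ℝ => |t| ^ (m : ℝ)) (A - B))).re ≤
      (Matrix.trace ((A - B) * (A ^ (m - 1) - B ^ (m - 1)))).re := by
  have hD : (A - B).IsHermitian := hA.isHermitian.sub hB.isHermitian
  set φ := Unitary.conjStarAlgAut ℂ (Matrix (Fin n) (Fin n) ℂ) (star hD.eigenvectorUnitary)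
    with hφ
  have hd : φ A - φ B = Matrix.diagonal fun i => (hD.eigenvalues i : ℂ) := by
    rw [← map_sub, hφ, hD.conjStarAlgAut_star_eigenvectorUnitary]
    rfl
  have htr : ((A - B) * (A ^ (m - 1) - B ^ (m - 1))).trace =
      ((φ A - φ B) * (φ A ^ (m - 1) - φ B ^ (m - 1))).trace := by
    rw [← Matrix.trace_conjStarAlgAut (star hD.eigenvectorUnitary), ← hφ]
    simp only [map_mul, map_sub, map_pow]
  rw [htr, hD.trace_cfc, Complex.re_sum]
  simp only [Complex.ofReal_re, Real.rpow_natCast]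
  obtain rfl | ⟨r, rfl⟩ : m = 2 ∨ ∃ r, m = r + 3 := by
    rcases Nat.lt_or_ge m 3 with h | h
    · left; omega
    · exact .inr ⟨m - 3, by omega⟩
  · have := Matrix.trace_diagonal_sq_mul_re hD.eigenvalues 1
    rw [← hd] at this
    simp only [mul_one, Matrix.one_apply_eq, Complex.one_re] at this
    simp [this]
  · exact Matrix.sum_abs_pow_le_of_sub_eq_diagonal (hA.conjStarAlgAut _) (hB.conjStarAlgAut _)
      hd r
end

section
/- Let n ≥ 1, let A and B be positive semidefinite n×n complex matrices such that A − B is positive semidefinite, and let p be a real number with 2 ≤ p ≤ 3. Then Re(trace((A − B)^p)) ≤ Re(trace((A − B) * (A^{p−1} − B^{p−1}))). -/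
open ComplexOrder

namespace Matrix

open scoped MatrixOrder

lemma PosSemidef.one_add_posDef {m : Type*} [DecidableEq m] {P : Matrix m m ℂ}
    (hP : P.PosSemidef) : (1 + P).PosDef :=
  PosDef.one.add_posSemidef hP

variable {m : Type*} [Fintype m] [DecidableEq m]

lemma PosSemidef.exists_eq_conjTranspose_mul_self {P : Matrix m m ℂ} (hP : P.PosSemidef) :
    ∃ S : Matrix m m ℂ, P = Sᴴ * S :=
  CStarAlgebra.nonneg_iff_eq_star_mul_self.mp hP.nonneg

lemma PosSemidef.trace_mul_nonneg {P Q : Matrix m m ℂ} (hP : P.PosSemidef)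
    (hQ : Q.PosSemidef) : 0 ≤ (P * Q).trace := by
  obtain ⟨S, rfl⟩ := hP.exists_eq_conjTranspose_mul_self
  rw [mul_assoc, trace_mul_comm]
  exact (hQ.mul_mul_conjTranspose_same S).trace_nonneg

lemma PosSemidef.one_sub_inv_one_add {P : Matrix m m ℂ} (hP : P.PosSemidef) :
    (1 - (1 + P)⁻¹).PosSemidef := by
  have hdet := (isUnit_iff_isUnit_det _).mp hP.one_add_posDef.isUnit
  have hinv := hP.one_add_posDef.inv.isHermitian
  have h := ((hP.add (posSemidef_conjTranspose_mul_self P)).mul_mul_conjTranspose_same (1 + P)⁻¹)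
  rw [hinv.eq, hP.isHermitian.eq] at h
  convert h using 1
  have e : P + P * P = (1 + P) * (1 + P) - (1 + P) := by noncomm_ring
  rw [e, mul_sub, sub_mul, nonsing_inv_mul_cancel_left _ _ hdet, mul_nonsing_inv _ hdet,
    nonsing_inv_mul _ hdet, one_mul]

lemma PosSemidef.one_sub_inv_one_add_sq {P : Matrix m m ℂ} (hP : P.PosSemidef) :
    (1 - (1 + P)⁻¹ * (1 + P)⁻¹).PosSemidef := by
  have hdet := (isUnit_iff_isUnit_det _).mp hP.one_add_posDef.isUnit
  have hinv := hP.one_add_posDef.inv.isHermitian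
  have h := ((hP.add (hP.add (posSemidef_conjTranspose_mul_self P))).mul_mul_conjTranspose_same
    (1 + P)⁻¹)
  rw [hinv.eq, hP.isHermitian.eq] at h
  convert h using 1
  have e : P + (P + P * P) = (1 + P) * (1 + P) - 1 := by noncomm_ring
  rw [e, mul_sub, sub_mul, nonsing_inv_mul_cancel_left _ _ hdet, mul_nonsing_inv _ hdet, mul_one]

/-- The trace of `P ↦ P + (1 + P)⁻¹` is monotone on positive semidefinite matrices. -/
lemma PosSemidef.trace_sub_inv_one_add_nonneg {K E : Matrix m m ℂ} (hK : K.PosSemidef)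
    (hE : E.PosSemidef) : 0 ≤ (E - (1 + K)⁻¹ + (1 + K + E)⁻¹).trace := by
  have hM := hK.one_add_posDef
  have hW := hM.add_posSemidef hE
  have hMdet := (isUnit_iff_isUnit_det _).mp hM.isUnit
  have hWdet := (isUnit_iff_isUnit_det _).mp hW.isUnit
  have hinv := hM.inv.isHermitian
  have h₂ := ((hW.inv.posSemidef.mul_mul_conjTranspose_same E).mul_mul_conjTranspose_same
    (1 + K)⁻¹).trace_nonneg
  have h₁ := hE.trace_mul_nonneg hK.one_sub_inv_one_add_sq
  rw [hE.isHermitian.eq, hinv.eq] at h₂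
  set M := 1 + K
  have hl : M⁻¹ - (M + E)⁻¹ = M⁻¹ * E * (M + E)⁻¹ := by
    have : E = (M + E) - M := by abel
    conv_rhs => rw [this, mul_sub, sub_mul, mul_assoc, ← this]
    rw [mul_nonsing_inv _ hWdet, nonsing_inv_mul _ hMdet, mul_one, one_mul]
  have hr : M⁻¹ - (M + E)⁻¹ = (M + E)⁻¹ * E * M⁻¹ := by
    have : E = (M + E) - M := by abel
    conv_rhs => rw [this, mul_sub, sub_mul, mul_assoc, mul_assoc, ← this]
    rw [nonsing_inv_mul_cancel_left _ _ hWdet, mul_nonsing_inv _ hMdet, mul_one]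
  have e : M⁻¹ * (E * (M + E)⁻¹ * E) * M⁻¹ = M⁻¹ * E * M⁻¹ - (M⁻¹ - (M + E)⁻¹) := by
    have : M⁻¹ * (E * (M + E)⁻¹ * E) * M⁻¹ = M⁻¹ * E * ((M + E)⁻¹ * E * M⁻¹) := by
      simp only [mul_assoc]
    rw [this, ← hr, mul_sub, ← hl]
  have e' : (M⁻¹ * E * M⁻¹).trace = (E * (M⁻¹ * M⁻¹)).trace := by
    rw [mul_assoc, trace_mul_comm, mul_assoc]
  have := add_nonneg h₁ h₂
  rw [e, mul_sub, mul_one, trace_sub, trace_sub, e'] at this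
  convert this using 1
  rw [trace_add, trace_sub, trace_sub]
  ring

lemma one_sub_mul_inv_mul_eq_inv {X S T : Matrix m m ℂ} (hX : IsUnit X.det)
    (hXS : IsUnit (X + T * S).det) :
    1 - S * (X + T * S)⁻¹ * T = (1 + S * X⁻¹ * T)⁻¹ := by
  symm
  apply inv_eq_left_inv
  have h : (X + T * S)⁻¹ + (X + T * S)⁻¹ * (T * S) * X⁻¹ = X⁻¹ := by
    calc _ = (X + T * S)⁻¹ * (X * X⁻¹) + (X + T * S)⁻¹ * (T * S) * X⁻¹ := by
          rw [mul_nonsing_inv _ hX, mul_one]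
      _ = (X + T * S)⁻¹ * (X + T * S) * X⁻¹ := by noncomm_ring
      _ = X⁻¹ := by rw [nonsing_inv_mul _ hXS, one_mul]
  calc _ = 1 + S * (X⁻¹ - ((X + T * S)⁻¹ + (X + T * S)⁻¹ * (T * S) * X⁻¹)) * T := by noncomm_ring
    _ = 1 := by rw [h, sub_self, mul_zero, zero_mul, add_zero]

lemma PosSemidef.trace_mul_inv_one_add_nonneg {B C : Matrix m m ℂ} (hB : B.PosSemidef)
    (hC : C.PosSemidef) :
    0 ≤ (C * ((1 + (B + C))⁻¹ - (1 + B)⁻¹ - (1 + C)⁻¹ + 1)).trace := by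
  have hX := hB.one_add_posDef
  have hXC := hX.add_posSemidef hC
  have hOC := hC.one_add_posDef
  obtain ⟨S, rfl⟩ := hC.exists_eq_conjTranspose_mul_self
  have hK := hX.inv.posSemidef.mul_mul_conjTranspose_same S
  have hE := hB.one_sub_inv_one_add.mul_mul_conjTranspose_same S
  have h := hK.trace_sub_inv_one_add_nonneg hE
  have w₁ := one_sub_mul_inv_mul_eq_inv (S := S) (T := Sᴴ)
    ((isUnit_iff_isUnit_det _).mp hX.isUnit) ((isUnit_iff_isUnit_det _).mp hXC.isUnit)
  have w₂ := one_sub_mul_inv_mul_eq_inv (X := 1) (S := S) (T := Sᴴ)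
    (by simp) ((isUnit_iff_isUnit_det _).mp hOC.isUnit)
  have e : 1 + S * (1 + B)⁻¹ * Sᴴ + S * (1 - (1 + B)⁻¹) * Sᴴ = 1 + S * 1⁻¹ * Sᴴ := by
    rw [inv_one]
    noncomm_ring
  rw [e, ← w₁, ← w₂] at h
  rw [mul_assoc, trace_mul_comm, ← add_assoc 1 B]
  convert h using 2
  noncomm_ring

lemma cfc_rpowIntegrand₁₂ {M : Matrix m m ℂ} (hM : M.PosSemidef) {q t : ℝ} (ht : 0 < t) :
    cfc (Real.rpowIntegrand₁₂ q t) M =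
      t ^ (q - 1) • (t⁻¹ • M + (1 + t⁻¹ • M)⁻¹ - 1) := by
  have hsa : IsSelfAdjoint M := hM.isHermitian
  have hc (f : ℝ → ℝ) : ContinuousOn f (spectrum ℝ M) :=
    (Matrix.finite_real_spectrum (A := M)).continuousOn f
  have hne : ∀ x ∈ spectrum ℝ M, 1 + t⁻¹ * x ≠ 0 := by
    intro x hx
    have : 0 ≤ x := spectrum_nonneg_of_nonneg hM.nonneg hx
    positivity
  have hf : Real.rpowIntegrand₁₂ q t =
      fun x => t ^ (q - 1) * (t⁻¹ * x + (1 + t⁻¹ * x)⁻¹ - 1) := by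
    ext x
    have : t + x = t * (1 + t⁻¹ * x) := by field_simp
    rw [Real.rpowIntegrand₁₂, this, mul_inv, mul_inv_cancel_left₀ ht.ne']
  rw [hf, cfc_const_mul _ _ _ (hc _), cfc_sub _ _ _ (hc _) (hc _), cfc_add _ _ _ (hc _) (hc _),
    cfc_inv _ _ hne (hc _), cfc_add _ _ _ (hc _) (hc _), cfc_const_mul _ _ _ (hc _),
    cfc_id' ℝ M, cfc_const_one ℝ M, ← nonsing_inv_eq_ringInverse]

lemma PosSemidef.re_trace_mul_cfc_rpowIntegrand₁₂_nonneg {B C : Matrix m m ℂ}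
    (hB : B.PosSemidef) (hC : C.PosSemidef) {q t : ℝ} (ht : 0 < t) :
    0 ≤ (C * (cfc (Real.rpowIntegrand₁₂ q t) (B + C) - cfc (Real.rpowIntegrand₁₂ q t) B
      - cfc (Real.rpowIntegrand₁₂ q t) C)).trace.re := by
  have ht' : 0 ≤ t⁻¹ := by positivity
  have h := (Complex.le_def.mp ((hB.smul ht').trace_mul_inv_one_add_nonneg (hC.smul ht'))).1
  rw [cfc_rpowIntegrand₁₂ (hB.add hC) ht, cfc_rpowIntegrand₁₂ hB ht, cfc_rpowIntegrand₁₂ hC ht,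
    ← smul_sub, ← smul_sub, mul_smul_comm, trace_smul, Complex.smul_re, smul_eq_mul]
  refine mul_nonneg (by positivity) ?_
  rw [smul_mul_assoc, trace_smul, Complex.smul_re, smul_eq_mul, Complex.zero_re] at h
  convert nonneg_of_mul_nonneg_right h (by positivity) using 4
  rw [smul_add]
  abel

/-- Traces against a function of a Hermitian matrix are weighted sums over the eigenvalues. -/
lemma IsHermitian.re_trace_mul_cfc {M : Matrix m m ℂ} (hM : M.IsHermitian) (C : Matrix m m ℂ)
    (f : ℝ → ℝ) :
    (C * cfc f M).trace.re = ∑ i, f (hM.eigenvalues i) *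
      ((star (hM.eigenvectorUnitary : Matrix m m ℂ) * C * hM.eigenvectorUnitary) i i).re := by
  rw [hM.cfc_eq, IsHermitian.cfc, Unitary.conjStarAlgAut_apply, ← mul_assoc, trace_mul_comm,
    ← mul_assoc, ← mul_assoc, trace]
  simp [mul_diagonal, mul_comm]

lemma PosSemidef.re_trace_mul_cfc_rpow_eq_integral {q : ℝ} {μ : MeasureTheory.Measure ℝ}
    (hμ : ∀ x ∈ Set.Ici (0 : ℝ),
      MeasureTheory.IntegrableOn (fun t => Real.rpowIntegrand₁₂ q t x) (Set.Ioi 0) μ ∧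
      x ^ q = ∫ t in Set.Ioi 0, Real.rpowIntegrand₁₂ q t x ∂μ)
    {M : Matrix m m ℂ} (hM : M.PosSemidef) (C : Matrix m m ℂ) :
    MeasureTheory.IntegrableOn
      (fun t => (C * cfc (Real.rpowIntegrand₁₂ q t) M).trace.re) (Set.Ioi 0) μ ∧
    (C * cfc (fun x : ℝ => x ^ q) M).trace.re =
      ∫ t in Set.Ioi 0, (C * cfc (Real.rpowIntegrand₁₂ q t) M).trace.re ∂μ := by
  simp only [hM.isHermitian.re_trace_mul_cfc]
  have hi := fun i => (hμ _ (hM.eigenvalues_nonneg i)).1.mul_const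
    ((star (hM.isHermitian.eigenvectorUnitary : Matrix m m ℂ) * C *
      hM.isHermitian.eigenvectorUnitary) i i).re
  refine ⟨MeasureTheory.integrable_finsetSum _ fun i _ => hi i, ?_⟩
  rw [MeasureTheory.integral_finsetSum _ fun i _ => hi i]
  refine Finset.sum_congr rfl fun i _ => ?_
  rw [MeasureTheory.integral_mul_const, (hμ _ (hM.eigenvalues_nonneg i)).2]

lemma PosSemidef.re_trace_mul_cfc_rpow_nonneg_of_mem_Ioo {B C : Matrix m m ℂ}
    (hB : B.PosSemidef) (hC : C.PosSemidef) {q : ℝ} (hq : q ∈ Set.Ioo (1 : ℝ) 2) :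
    0 ≤ (C * (cfc (fun x : ℝ => x ^ q) (B + C) - cfc (fun x : ℝ => x ^ q) B
      - cfc (fun x : ℝ => x ^ q) C)).trace.re := by
  obtain ⟨μ, hμ⟩ := Real.exists_measure_rpow_eq_integral_rpowIntegrand₁₂ hq
  obtain ⟨iA, eA⟩ := (hB.add hC).re_trace_mul_cfc_rpow_eq_integral hμ C
  obtain ⟨iB, eB⟩ := hB.re_trace_mul_cfc_rpow_eq_integral hμ C
  obtain ⟨iC, eC⟩ := hC.re_trace_mul_cfc_rpow_eq_integral hμ C
  rw [mul_sub, mul_sub, trace_sub, trace_sub, Complex.sub_re, Complex.sub_re, eA, eB, eC,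
    ← MeasureTheory.integral_sub' iA iB, ← MeasureTheory.integral_sub' (iA.sub iB) iC]
  refine MeasureTheory.setIntegral_nonneg measurableSet_Ioi fun t ht => ?_
  simpa only [Pi.sub_apply, mul_sub, trace_sub, Complex.sub_re] using
    hB.re_trace_mul_cfc_rpowIntegrand₁₂_nonneg hC (q := q) ht

lemma IsHermitian.continuousOn_re_trace_mul_cfc_rpow {M : Matrix m m ℂ} (hM : M.IsHermitian)
    (C : Matrix m m ℂ) :
    ContinuousOn (fun q : ℝ => (C * cfc (fun x : ℝ => x ^ q) M).trace.re) (Set.Ioi 0) := by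
  simp only [hM.re_trace_mul_cfc]
  refine continuousOn_finsetSum _ fun i _ => ContinuousOn.mul (fun q hq => ?_) continuousOn_const
  exact (Real.continuousAt_const_rpow' (ne_of_gt hq)).continuousWithinAt

lemma PosSemidef.re_trace_mul_cfc_rpow_nonneg {B C : Matrix m m ℂ}
    (hB : B.PosSemidef) (hC : C.PosSemidef) {q : ℝ} (hq : q ∈ Set.Icc (1 : ℝ) 2) :
    0 ≤ (C * (cfc (fun x : ℝ => x ^ q) (B + C) - cfc (fun x : ℝ => x ^ q) B
      - cfc (fun x : ℝ => x ^ q) C)).trace.re := by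
  have hcl : closure (Set.Ioo (1 : ℝ) 2) = Set.Icc 1 2 := closure_Ioo (by norm_num)
  have hc : ContinuousOn (fun q : ℝ => (C * (cfc (fun x : ℝ => x ^ q) (B + C)
      - cfc (fun x : ℝ => x ^ q) B - cfc (fun x : ℝ => x ^ q) C)).trace.re) (Set.Ioi 0) := by
    simp only [mul_sub, trace_sub, Complex.sub_re]
    exact (((hB.add hC).isHermitian.continuousOn_re_trace_mul_cfc_rpow C).sub
      (hB.isHermitian.continuousOn_re_trace_mul_cfc_rpow C)).sub
      (hC.isHermitian.continuousOn_re_trace_mul_cfc_rpow C)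
  refine le_on_closure (f := fun _ : ℝ => (0 : ℝ))
    (fun _ hr => hB.re_trace_mul_cfc_rpow_nonneg_of_mem_Ioo hC hr) continuousOn_const
    (hc.mono ?_) (hcl ▸ hq)
  rw [hcl]
  exact fun r hr => lt_of_lt_of_le one_pos hr.1

lemma PosSemidef.mul_cfc_rpow {C : Matrix m m ℂ} (hC : C.PosSemidef) {p : ℝ} (hp : p ≠ 0) :
    C * cfc (fun x : ℝ => x ^ (p - 1)) C = cfc (fun x : ℝ => x ^ p) C := by
  have hsa : IsSelfAdjoint C := hC.isHermitian
  have hc (f : ℝ → ℝ) : ContinuousOn f (spectrum ℝ C) :=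
    (Matrix.finite_real_spectrum (A := C)).continuousOn f
  conv_lhs => enter [1]; rw [← cfc_id' ℝ C]
  rw [← cfc_mul _ _ _ (hc _) (hc _)]
  refine cfc_congr fun x hx => ?_
  have hx : 0 ≤ x := spectrum_nonneg_of_nonneg hC.nonneg hx
  have := Real.rpow_add_one' hx (y := p - 1) (by simpa using hp)
  rw [sub_add_cancel] at this
  simp only [this, mul_comm]

end Matrix

/-- For `n ≥ 1`, positive semidefinite `n × n` complex matrices `A, B` with `A - B`
positive semidefinite, and a real `p` with `2 ≤ p ≤ 3`,
`Re (trace ((A - B)^p)) ≤ Re (trace ((A - B) * (A^(p-1) - B^(p-1))))`, the real powers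
being given by the continuous functional calculus. -/
theorem stmt_5 (n : ℕ) (hn : 1 ≤ n) (A B : Matrix (Fin n) (Fin n) ℂ)
    (hA : A.PosSemidef) (hB : B.PosSemidef) (hAB : (A - B).PosSemidef)
    (p : ℝ) (hp1 : 2 ≤ p) (hp2 : p ≤ 3) :
    (Matrix.trace (cfc (fun t : ℝ => t ^ p) (A - B))).re ≤
      (Matrix.trace ((A - B) *
        (cfc (fun t : ℝ => t ^ (p - 1)) A - cfc (fun t : ℝ => t ^ (p - 1)) B))).re := by
  have h := hB.re_trace_mul_cfc_rpow_nonneg hAB (q := p - 1) ⟨by linarith, by linarith⟩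
  rw [mul_sub, hAB.mul_cfc_rpow (by linarith), add_sub_cancel, Matrix.trace_sub,
    Complex.sub_re] at h
  linarith
end

section
/- Let n ≥ 1, let B be a positive semidefinite n×n complex matrix and Δ a Hermitian n×n complex matrix such that B + Δ is positive semidefinite, let r be a real number and m ≥ 1 a natural number with r ≥ m. Then trace(Δ * ((B+Δ)^r − B^r)) = trace(Δ * ((B+Δ)^{r−m} − B^{r−m}) * B^m) + Σ_{k=1}^{m} trace(Δ * (B+Δ)^{r−k} * Δ * B^{k−1}). -/
open ComplexOrder

namespace Matrix.PosSemidef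

variable {n : Type*} [Fintype n] [DecidableEq n]

/-- For `s ≥ 1`, the power `A ^ s` of a positive semidefinite matrix splits off a factor `A`. -/
theorem cfc_rpow_eq_mul_self {A : Matrix n n ℂ} (hA : A.PosSemidef) {s : ℝ} (hs : 1 ≤ s) :
    cfc (fun t : ℝ => t ^ s) A = cfc (fun t : ℝ => t ^ (s - 1)) A * A := by
  have hsa : IsSelfAdjoint A := hA.isHermitian
  have hcont : ContinuousOn (fun t : ℝ => t ^ (s - 1)) (spectrum ℝ A) :=
    (Real.continuous_rpow_const (sub_nonneg.2 hs)).continuousOn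
  calc cfc (fun t : ℝ => t ^ s) A = cfc (fun t : ℝ => t ^ (s - 1) * t) A := by
        refine cfc_congr fun t ht => ?_
        rw [hA.isHermitian.spectrum_real_eq_range_eigenvalues] at ht
        obtain ⟨i, rfl⟩ := ht
        have h := Real.rpow_add_one' (hA.eigenvalues_nonneg i) (y := s - 1) (by linarith)
        simpa using h
    _ = cfc (fun t : ℝ => t ^ (s - 1)) A * A := by
        rw [cfc_mul _ (fun t : ℝ => t) A hcont continuousOn_id, cfc_id' ℝ A]

/-- Iterated splitting of a difference of real powers of positive semidefinite matrices. -/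
theorem cfc_rpow_sub_eq_sum {B D : Matrix n n ℂ} (hB : B.PosSemidef) (hBD : (B + D).PosSemidef)
    {r : ℝ} {m : ℕ} (hrm : (m : ℝ) ≤ r) :
    cfc (fun t : ℝ => t ^ r) (B + D) - cfc (fun t : ℝ => t ^ r) B =
      (cfc (fun t : ℝ => t ^ (r - m)) (B + D) - cfc (fun t : ℝ => t ^ (r - m)) B) * B ^ m +
        ∑ k ∈ Finset.Icc 1 m,
          cfc (fun t : ℝ => t ^ (r - k)) (B + D) * D * B ^ (k - 1) := by
  induction m with
  | zero => simp
  | succ m ih =>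
    push_cast at hrm
    rw [ih (by linarith), Finset.sum_Icc_succ_top (by omega),
      hB.cfc_rpow_eq_mul_self (s := r - m) (by linarith),
      hBD.cfc_rpow_eq_mul_self (s := r - m) (by linarith)]
    rw [Nat.add_sub_cancel]
    push_cast
    rw [← sub_sub, pow_succ']
    noncomm_ring

end Matrix.PosSemidef

/-- For `n ≥ 1`, a positive semidefinite `n × n` complex matrix `B`, a Hermitian `Δ`
with `B + Δ` positive semidefinite, a real `r` and a natural number `m ≥ 1` with
`r ≥ m`, one has the identity
`trace (Δ * ((B+Δ)^r - B^r)) = trace (Δ * ((B+Δ)^(r-m) - B^(r-m)) * B^m)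
  + ∑_{k=1}^m trace (Δ * (B+Δ)^(r-k) * Δ * B^(k-1))`,
where the real powers are given by the continuous functional calculus and `B^m`,
`B^(k-1)` are ordinary matrix powers. -/
theorem stmt_8 (n : ℕ) (hn : 1 ≤ n) (B Δ : Matrix (Fin n) (Fin n) ℂ)
    (hB : B.PosSemidef) (hΔ : Δ.IsHermitian) (hBΔ : (B + Δ).PosSemidef)
    (r : ℝ) (m : ℕ) (hm : 1 ≤ m) (hrm : (m : ℝ) ≤ r) :
    Matrix.trace (Δ * (cfc (fun t : ℝ => t ^ r) (B + Δ) - cfc (fun t : ℝ => t ^ r) B)) =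
      Matrix.trace (Δ *
          (cfc (fun t : ℝ => t ^ (r - m)) (B + Δ) - cfc (fun t : ℝ => t ^ (r - m)) B) *
          B ^ m) +
        ∑ k ∈ Finset.Icc 1 m,
          Matrix.trace (Δ * cfc (fun t : ℝ => t ^ (r - k)) (B + Δ) * Δ * B ^ (k - 1)) := by
  rw [hB.cfc_rpow_sub_eq_sum hBΔ hrm, mul_add, Matrix.trace_add, Finset.mul_sum,
    Matrix.trace_sum]
  simp only [mul_assoc]
end

section
/- Let n ≥ 1, let A be a positive semidefinite n×n complex matrix, let Q be an n×n complex matrix with Q * Q = Q and Qᴴ = Q (an orthogonal projection matrix), and let r be a real number with 1 ≤ r ≤ 2. Then (Q A Q)^r ≤ Q A^r Q in the Loewner order, i.e. Q A^r Q − (Q A Q)^r is positive semidefinite. -/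
open ComplexOrder Matrix

theorem Polynomial.aeval_mul_comm_mul {R A : Type*} [CommSemiring R] [Semiring A] [Algebra R A]
    (p : Polynomial R) (x y : A) :
    Polynomial.aeval (y * x) p * y = y * Polynomial.aeval (x * y) p := by
  induction p using Polynomial.induction_on' with
  | add p q hp hq => simp [add_mul, mul_add, hp, hq]
  | monomial k a =>
    simp [Polynomial.aeval_monomial, Algebra.algebraMap_eq_smul_one, mul_pow_mul]

theorem Polynomial.exists_eqOn_eval_of_finite {F : Type*} [Field F] {s : Set F} (hs : s.Finite)
    (f : F → F) : ∃ p : Polynomial F, s.EqOn f fun t => p.eval t := by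
  classical
  refine ⟨Lagrange.interpolate hs.toFinset id f, fun t ht => ?_⟩
  exact (Lagrange.eval_interpolate_at_node f (Set.injOn_id _) (hs.mem_toFinset.2 ht)).symm

section LoewnerHeinz

open scoped MatrixOrder Matrix.Norms.L2Operator

variable {n : Type*} [Fintype n] [DecidableEq n]

/-- The Löwner–Heinz inequality for matrices. -/
theorem Matrix.PosSemidef.cfc_rpow_mono {A B : Matrix n n ℂ} (hA : A.PosSemidef)
    (hAB : (B - A).PosSemidef) {s : ℝ} (hs : s ∈ Set.Icc 0 1) :
    (cfc (fun t : ℝ => t ^ s) B - cfc (fun t : ℝ => t ^ s) A).PosSemidef := by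
  have h : A ≤ B := hAB
  have h0 : 0 ≤ A := hA.nonneg
  have hmono : A ^ s ≤ B ^ s := CFC.rpow_le_rpow hs h
  rw [CFC.rpow_eq_cfc_real h0, CFC.rpow_eq_cfc_real (h0.trans h)] at hmono
  exact hmono

end LoewnerHeinz

section MatrixFunctionalCalculus

variable {n : Type*} [Fintype n] [DecidableEq n]

theorem Matrix.continuousOn_spectrum_real (A : Matrix n n ℂ) (f : ℝ → ℝ) :
    ContinuousOn f (spectrum ℝ A) :=
  A.finite_real_spectrum.continuousOn f

theorem Matrix.cfc_conjTranspose_mul_self_mul (X : Matrix n n ℂ) (f : ℝ → ℝ) :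
    cfc f (Xᴴ * X) * Xᴴ = Xᴴ * cfc f (X * Xᴴ) := by
  obtain ⟨p, hp⟩ := Polynomial.exists_eqOn_eval_of_finite
    ((Xᴴ * X).finite_real_spectrum.union (X * Xᴴ).finite_real_spectrum) f
  have h₁ : IsSelfAdjoint (Xᴴ * X) := isHermitian_conjTranspose_mul_self X
  have h₂ : IsSelfAdjoint (X * Xᴴ) := isHermitian_mul_conjTranspose_self X
  rw [cfc_congr (hp.mono Set.subset_union_left), cfc_congr (hp.mono Set.subset_union_right),
    cfc_polynomial p _ h₁, cfc_polynomial p _ h₂, Polynomial.aeval_mul_comm_mul]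

theorem Matrix.PosSemidef.nonneg_of_mem_spectrum_real {A : Matrix n n ℂ} (hA : A.PosSemidef)
    {t : ℝ} (ht : t ∈ spectrum ℝ A) : 0 ≤ t := by
  rw [hA.isHermitian.spectrum_real_eq_range_eigenvalues] at ht
  obtain ⟨i, rfl⟩ := ht
  exact hA.eigenvalues_nonneg i

theorem Matrix.PosSemidef.cfc_rpow_one_add {A : Matrix n n ℂ} (hA : A.PosSemidef) {s : ℝ}
    (hs : 0 ≤ s) :
    cfc (fun t : ℝ => t ^ (1 + s)) A = cfc (fun t : ℝ => t ^ s) A * A := by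
  have hsa : IsSelfAdjoint A := hA.isHermitian
  have h : cfc (fun t : ℝ => t ^ (1 + s)) A = cfc (fun t : ℝ => t ^ s * t) A := by
    refine cfc_congr fun t ht => ?_
    have ht0 := hA.nonneg_of_mem_spectrum_real ht
    simp only [add_comm 1 s, Real.rpow_add_of_nonneg ht0 hs zero_le_one, Real.rpow_one]
  rw [h, cfc_mul _ _ A (continuousOn_spectrum_real _ _) (continuousOn_spectrum_real _ _),
    cfc_id' ℝ A hsa]

/-- The operator Jensen inequality for compressions and the powers `t ↦ t ^ r`, `r ∈ [1, 2]`. -/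
theorem Matrix.posSemidef_compression_cfc_rpow {A Q : Matrix n n ℂ}
    (hA : A.PosSemidef) (hQ : Q * Q = Q) (hQH : Qᴴ = Q) {r : ℝ} (hr1 : 1 ≤ r) (hr2 : r ≤ 2) :
    (Q * cfc (fun t : ℝ => t ^ r) A * Q - cfc (fun t : ℝ => t ^ r) (Q * A * Q)).PosSemidef := by
  obtain ⟨s, rfl⟩ : ∃ s, r = 1 + s := ⟨r - 1, by ring⟩
  have hs : s ∈ Set.Icc (0 : ℝ) 1 := ⟨by linarith, by linarith⟩
  set S : Matrix n n ℂ := cfc Real.sqrt A with hS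
  set P : Matrix n n ℂ := cfc (fun t : ℝ => t ^ s) A with hP
  have hsa : IsSelfAdjoint A := hA.isHermitian
  have hSH : Sᴴ = S := cfc_predicate Real.sqrt A
  have hSS : S * S = A := by
    rw [hS, ← cfc_mul _ _ A (continuousOn_spectrum_real _ _) (continuousOn_spectrum_real _ _)]
    conv_rhs => rw [← cfc_id' ℝ A hsa]
    exact cfc_congr fun t ht => Real.mul_self_sqrt (hA.nonneg_of_mem_spectrum_real ht)
  have hSP : S * P = P * S := cfc_commute_cfc Real.sqrt _ A
  have hX : (S * Q)ᴴ * (S * Q) = Q * A * Q := by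
    rw [conjTranspose_mul, hSH, hQH, ← hSS]; simp only [mul_assoc]
  have hX' : (S * Q) * (S * Q)ᴴ = S * Q * S := by
    rw [conjTranspose_mul, hSH, hQH, ← mul_assoc, mul_assoc S, hQ]
  have hB : (Q * A * Q).PosSemidef := hX ▸ posSemidef_conjTranspose_mul_self _
  have hle : (S * Q * S).PosSemidef := hX' ▸ posSemidef_self_mul_conjTranspose _
  have hdiff : (A - S * Q * S).PosSemidef := by
    have h : A - S * Q * S = ((1 - Q) * S)ᴴ * ((1 - Q) * S) := by
      have hQ' : (1 - Q) * (1 - Q) = 1 - Q := by simp [sub_mul, mul_sub, hQ]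
      rw [conjTranspose_mul, conjTranspose_sub, conjTranspose_one, hSH, hQH, mul_assoc S (1 - Q),
        ← mul_assoc (1 - Q), hQ', sub_mul, mul_sub, one_mul, hSS, mul_assoc]
    exact h ▸ posSemidef_conjTranspose_mul_self _
  have key := (hle.cfc_rpow_mono hdiff hs).conjTranspose_mul_mul_same (S * Q)
  have h₁ : cfc (fun t : ℝ => t ^ (1 + s)) (Q * A * Q)
      = (S * Q)ᴴ * cfc (fun t : ℝ => t ^ s) (S * Q * S) * (S * Q) := by
    rw [hB.cfc_rpow_one_add hs.1, ← hX', ← cfc_conjTranspose_mul_self_mul, hX,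
      mul_assoc _ _ (S * Q), hX]
  have h₂ : Q * cfc (fun t : ℝ => t ^ (1 + s)) A * Q = (S * Q)ᴴ * P * (S * Q) := by
    rw [hA.cfc_rpow_one_add hs.1, ← hP, conjTranspose_mul, hSH, hQH, ← hSS]
    simp only [← mul_assoc]
    rw [mul_assoc Q S P, hSP, ← mul_assoc]
  rw [h₁, h₂, ← sub_mul, ← mul_sub]
  exact key

end MatrixFunctionalCalculus

/-- For `n ≥ 1`, a positive semidefinite `n × n` complex matrix `A`, an orthogonal
projection matrix `Q` (`Q * Q = Q`, `Qᴴ = Q`) and a real `r` with `1 ≤ r ≤ 2`,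
`(Q A Q)^r ≤ Q A^r Q` in the Loewner order, i.e. `Q A^r Q - (Q A Q)^r` is positive
semidefinite; the real powers are given by the continuous functional calculus. -/
theorem stmt_12 (n : ℕ) (hn : 1 ≤ n) (A Q : Matrix (Fin n) (Fin n) ℂ)
    (hA : A.PosSemidef) (hQ : Q * Q = Q) (hQH : Qᴴ = Q)
    (r : ℝ) (hr1 : 1 ≤ r) (hr2 : r ≤ 2) :
    (Q * cfc (fun t : ℝ => t ^ r) A * Q - cfc (fun t : ℝ => t ^ r) (Q * A * Q)).PosSemidef :=
  posSemidef_compression_cfc_rpow hA hQ hQH hr1 hr2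
end

section
/- Let n ≥ 1, let A be a positive semidefinite n×n complex matrix, let D be the diagonal matrix whose diagonal entries are those of A, and let p ≥ 2 be a real number. Then Re(trace(|A − D|^p)) ≤ Re(trace(A^p)). -/
open ComplexOrder

namespace Matrix

variable {n : Type*} [Fintype n] [DecidableEq n]

theorem IsHermitian.exists_re_trace_mul_cfc_eq_sum {N : Matrix n n ℂ} (hN : N.IsHermitian)
    (B : Matrix n n ℂ) :
    ∃ w : n → ℝ, ∀ g : ℝ → ℝ,
      (trace (B * cfc g N)).re = ∑ j, g (hN.eigenvalues j) * w j := by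
  set V : Matrix n n ℂ := (hN.eigenvectorUnitary : Matrix n n ℂ) with hV
  refine ⟨fun j => ((star V * B * V) j j).re, fun g => ?_⟩
  rw [hN.cfc_eq, IsHermitian.cfc, Unitary.conjStarAlgAut_apply, ← hV, ← mul_assoc, ← mul_assoc,
    trace_mul_comm, ← mul_assoc, ← mul_assoc]
  simp [trace, mul_diagonal, mul_comm]

theorem IsHermitian.exists_re_trace_cfc_mul_cfc_eq_sum {M N : Matrix n n ℂ} (hM : M.IsHermitian)
    (hN : N.IsHermitian) :
    ∃ w : n → n → ℝ, (∀ i j, 0 ≤ w i j) ∧ ∀ f g : ℝ → ℝ,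
      (trace (cfc f M * cfc g N)).re =
        ∑ i, ∑ j, f (hM.eigenvalues i) * g (hN.eigenvalues j) * w i j := by
  set U : Matrix n n ℂ := (hM.eigenvectorUnitary : Matrix n n ℂ) with hU
  set V : Matrix n n ℂ := (hN.eigenvectorUnitary : Matrix n n ℂ) with hV
  refine ⟨fun i j => Complex.normSq ((star U * V) i j), fun i j => Complex.normSq_nonneg _,
    fun f g => ?_⟩
  rw [hM.cfc_eq, hN.cfc_eq, IsHermitian.cfc, IsHermitian.cfc, Unitary.conjStarAlgAut_apply,
    Unitary.conjStarAlgAut_apply, ← hU, ← hV]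
  set F : Matrix n n ℂ := diagonal (RCLike.ofReal ∘ f ∘ hM.eigenvalues) with hF
  set G : Matrix n n ℂ := diagonal (RCLike.ofReal ∘ g ∘ hN.eigenvalues) with hG
  have h : trace (U * F * star U * (V * G * star V)) =
      trace (F * (star U * V) * G * star (star U * V)) := by
    rw [mul_assoc U, mul_assoc U, trace_mul_comm, star_mul, star_star]
    simp only [mul_assoc]
  rw [h]
  simp only [trace, diag, hF, hG, Complex.re_sum]
  refine Finset.sum_congr rfl fun i _ => ?_
  rw [mul_apply, Complex.re_sum]
  refine Finset.sum_congr rfl fun j _ => ?_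
  rw [mul_diagonal, diagonal_mul, star_apply]
  have : ∀ (a b : ℝ) (z : ℂ), ((a : ℂ) * z * b * star z).re = a * b * Complex.normSq z := by
    intro a b z
    simp [Complex.normSq_apply]
    ring
  exact this _ _ _

/-- **Klein's inequality**. -/
theorem IsHermitian.sum_re_trace_cfc_mul_cfc_nonneg {ι : Type*} [Fintype ι] {M N : Matrix n n ℂ}
    (hM : M.IsHermitian) (hN : N.IsHermitian) (c : ι → ℝ) (f g : ι → ℝ → ℝ)
    (h : ∀ x ∈ spectrum ℝ M, ∀ y ∈ spectrum ℝ N, 0 ≤ ∑ k, c k * (f k x * g k y)) :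
    0 ≤ ∑ k, c k * (trace (cfc (f k) M * cfc (g k) N)).re := by
  obtain ⟨w, hw, hsum⟩ := hM.exists_re_trace_cfc_mul_cfc_eq_sum hN
  simp only [hsum, Finset.mul_sum]
  rw [Finset.sum_comm]
  refine Finset.sum_nonneg fun i _ => ?_
  rw [Finset.sum_comm]
  refine Finset.sum_nonneg fun j _ => ?_
  simp only [← mul_assoc]
  rw [← Finset.sum_mul]
  refine mul_nonneg ?_ (hw i j)
  simpa only [mul_assoc] using h _ (hM.eigenvalues_mem_spectrum_real i) _
    (hN.eigenvalues_mem_spectrum_real j)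

open scoped MatrixOrder in
theorem PosSemidef.exists_eq_conjTranspose_mul_self_s14 {M : Matrix n n ℂ} (hM : M.PosSemidef) :
    ∃ S : Matrix n n ℂ, M = Sᴴ * S :=
  CStarAlgebra.nonneg_iff_eq_star_mul_self.mp hM.nonneg

theorem PosSemidef.re_trace_mul_nonneg {M N : Matrix n n ℂ} (hM : M.PosSemidef)
    (hN : N.PosSemidef) : 0 ≤ (trace (M * N)).re := by
  obtain ⟨S, rfl⟩ := hM.exists_eq_conjTranspose_mul_self_s14
  rw [mul_assoc, trace_mul_comm]
  exact (Complex.nonneg_iff.mp (hN.mul_mul_conjTranspose_same S).trace_nonneg).1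

theorem continuousOn_spectrum_real_s14 (f : ℝ → ℝ) (M : Matrix n n ℂ) :
    ContinuousOn f (spectrum ℝ M) :=
  M.finite_real_spectrum.continuousOn f

theorem cfc_mul_cfc (f g : ℝ → ℝ) (M : Matrix n n ℂ) :
    cfc f M * cfc g M = cfc (fun x => f x * g x) M :=
  (cfc_mul f g M (continuousOn_spectrum_real_s14 f M) (continuousOn_spectrum_real_s14 g M)).symm

theorem IsHermitian.cfc_cfc {M : Matrix n n ℂ} (hM : M.IsHermitian) (f g : ℝ → ℝ) :
    cfc g (cfc f M) = cfc (fun x => g (f x)) M :=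
  (cfc_comp' g f M ((M.finite_real_spectrum.image f).continuousOn g)
    (continuousOn_spectrum_real_s14 f M) hM).symm

theorem PosSemidef.nonneg_of_mem_spectrum {M : Matrix n n ℂ} (hM : M.PosSemidef) {x : ℝ}
    (hx : x ∈ spectrum ℝ M) : 0 ≤ x := by
  rw [hM.isHermitian.spectrum_real_eq_range_eigenvalues] at hx
  obtain ⟨i, rfl⟩ := hx
  exact hM.eigenvalues_nonneg i

open scoped MatrixOrder in
theorem posSemidef_cfc_s14 {f : ℝ → ℝ} {M : Matrix n n ℂ} (h : ∀ x ∈ spectrum ℝ M, 0 ≤ f x) :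
    (cfc f M).PosSemidef :=
  nonneg_iff_posSemidef.mp (cfc_nonneg h)

theorem PosSemidef.cfc_inv_mul {M : Matrix n n ℂ} (hM : M.PosSemidef) {t : ℝ} (ht : 0 < t) :
    cfc (fun x : ℝ => (t + x)⁻¹) M * ((t : ℂ) • 1 + M) = 1 := by
  have h : ((t : ℂ) • 1 + M) = cfc (fun x : ℝ => t + x) M := by
    rw [cfc_const_add (R := ℝ) t (fun x => x) M (continuousOn_spectrum_real_s14 _ M)
      hM.isHermitian.isSelfAdjoint,
      cfc_id' ℝ M hM.isHermitian.isSelfAdjoint]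
    simp [Algebra.algebraMap_eq_smul_one]
  rw [h, cfc_mul_cfc, ← cfc_one ℝ M hM.isHermitian.isSelfAdjoint]
  refine cfc_congr fun x hx => ?_
  have := hM.nonneg_of_mem_spectrum hx
  simp only [Pi.one_apply]
  exact inv_mul_cancel₀ (by positivity)

theorem mul_mul_conjTranspose_eq_one_sub {S G R Q J : Matrix n n ℂ} (hR : G * R = 1)
    (hQ : Q * (G + Sᴴ * S) = 1) (hJ : (1 + S * R * Sᴴ) * J = 1) :
    S * Q * Sᴴ = 1 - J := by
  have h : S * Q * Sᴴ * (1 + S * R * Sᴴ) = S * R * Sᴴ := by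
    calc S * Q * Sᴴ * (1 + S * R * Sᴴ)
        = S * Q * (1 + Sᴴ * S * R) * Sᴴ := by noncomm_ring
      _ = S * (Q * (G + Sᴴ * S)) * R * Sᴴ := by rw [← hR]; noncomm_ring
      _ = S * R * Sᴴ := by rw [hQ, mul_one]
  calc S * Q * Sᴴ = S * Q * Sᴴ * ((1 + S * R * Sᴴ) * J) := by rw [hJ, mul_one]
    _ = ((1 + S * R * Sᴴ) - 1) * J := by rw [← mul_assoc, h, add_sub_cancel_left]
    _ = 1 - J := by rw [sub_mul, hJ, one_mul]

theorem PosSemidef.re_trace_sub_trace_resolvent_le {K L : Matrix n n ℂ} (hK : K.PosSemidef)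
    (hL : L.PosSemidef) (hKL : (L - K).PosSemidef) :
    (trace (cfc (fun x : ℝ => (1 + x)⁻¹) K)).re - (trace (cfc (fun x : ℝ => (1 + x)⁻¹) L)).re ≤
      (trace L).re - (trace K).re := by
  set r : ℝ → ℝ := fun x => (1 + x)⁻¹ with hr
  set φ : ℝ → ℝ := fun x => 1 - r x * r x with hφ
  have h1 := hK.isHermitian.sum_re_trace_cfc_mul_cfc_nonneg hL.isHermitian
    ![1, 1, -1, 1, -1, -1] ![1, 1, φ, fun x => φ x * x, r, id] ![r, id, id, 1, 1, 1] (by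
      intro k hk l hl
      replace hk := hK.nonneg_of_mem_spectrum hk
      replace hl := hL.nonneg_of_mem_spectrum hl
      have key : r l + l - φ k * l + φ k * k - r k - k = (l - k) ^ 2 * (r k * r k * r l) := by
        simp only [hφ, hr]
        field_simp
        ring
      have : 0 ≤ (l - k) ^ 2 * (r k * r k * r l) := by positivity
      rw [← key] at this
      simp [Fin.sum_univ_succ]
      linarith)
  have h2 : 0 ≤ (trace (cfc φ K * (L - K))).re := by
    refine (posSemidef_cfc_s14 fun x hx => ?_).re_trace_mul_nonneg hKL
    have hx := hK.nonneg_of_mem_spectrum hx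
    have : r x ≤ 1 := inv_le_one_of_one_le₀ (by linarith)
    exact sub_nonneg.mpr (mul_le_one₀ this (by positivity) this)
  have h3 : cfc (fun x => φ x * x) K = cfc φ K * K := by
    rw [← cfc_mul_cfc, cfc_id' ℝ K hK.isHermitian.isSelfAdjoint]
  simp [Fin.sum_univ_succ, cfc_one ℝ K hK.isHermitian.isSelfAdjoint,
    cfc_one ℝ L hL.isHermitian.isSelfAdjoint,
    cfc_id ℝ K hK.isHermitian.isSelfAdjoint, cfc_id ℝ L hL.isHermitian.isSelfAdjoint, h3] at h1
  rw [mul_sub, trace_sub, Complex.sub_re] at h2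
  linarith

theorem PosSemidef.re_trace_mul_resolvent_sub_le {B C : Matrix n n ℂ} (hB : B.PosSemidef)
    (hC : C.PosSemidef) {t : ℝ} (ht : 0 < t) :
    (trace (B * cfc (fun x : ℝ => (t + x)⁻¹) C)).re -
        (trace (B * cfc (fun x : ℝ => (t + x)⁻¹) (B + C))).re ≤
      t⁻¹ * (trace B).re - (trace (B * cfc (fun x : ℝ => (t + x)⁻¹) B)).re := by
  obtain ⟨S, hS⟩ := hB.exists_eq_conjTranspose_mul_self_s14
  set r : ℝ → ℝ := fun x => (t + x)⁻¹ with hr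
  have htr : ∀ N : Matrix n n ℂ, trace (B * N) = trace (S * N * Sᴴ) := fun N => by
    rw [hS, mul_assoc, trace_mul_comm]
  have hR : (cfc r C).PosSemidef := posSemidef_cfc_s14 fun x hx => by
    have := hC.nonneg_of_mem_spectrum hx
    positivity
  have hRt : (((t⁻¹ : ℝ) : ℂ) • 1 - cfc r C).PosSemidef := by
    have : ((t⁻¹ : ℝ) : ℂ) • 1 - cfc r C = cfc (fun x => t⁻¹ - r x) C := by
      rw [cfc_sub (R := ℝ) (fun _ => t⁻¹) r C (continuousOn_spectrum_real_s14 _ C)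
        (continuousOn_spectrum_real_s14 _ C), cfc_const t⁻¹ C hC.isHermitian.isSelfAdjoint]
      ext i j
      simp [Algebra.algebraMap_eq_smul_one]
    rw [this]
    refine posSemidef_cfc_s14 fun x hx => ?_
    have := hC.nonneg_of_mem_spectrum hx
    exact sub_nonneg.mpr (inv_anti₀ ht (by linarith))
  have hK := hR.mul_mul_conjTranspose_same S
  have hL : (S * (((t⁻¹ : ℝ) : ℂ) • 1) * Sᴴ).PosSemidef := by
    refine PosSemidef.mul_mul_conjTranspose_same ?_ S
    refine PosSemidef.one.smul ?_
    rw [Complex.zero_le_real]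
    positivity
  have hKL : (S * (((t⁻¹ : ℝ) : ℂ) • 1) * Sᴴ - S * cfc r C * Sᴴ).PosSemidef := by
    rw [← sub_mul, ← mul_sub]
    exact hRt.mul_mul_conjTranspose_same S
  have hone : ∀ {N : Matrix n n ℂ}, N.PosSemidef →
      (1 + N) * cfc (fun x : ℝ => (1 + x)⁻¹) N = 1 := fun {N} hN => by
    rw [mul_eq_one_comm]
    simpa using hN.cfc_inv_mul one_pos
  have hKt := mul_mul_conjTranspose_eq_one_sub (S := S) (Q := cfc r (B + C))
    (mul_eq_one_comm.mp (hC.cfc_inv_mul ht))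
    (by rw [← hS, add_assoc, add_comm C]; exact (hB.add hC).cfc_inv_mul ht) (hone hK)
  have hLt := mul_mul_conjTranspose_eq_one_sub (S := S) (Q := cfc r B) (G := (t : ℂ) • 1)
    (R := ((t⁻¹ : ℝ) : ℂ) • 1) (by
      rw [smul_mul_smul_comm, ← Complex.ofReal_mul, mul_inv_cancel₀ ht.ne']; simp)
    (by rw [← hS]; exact hB.cfc_inv_mul ht) (hone hL)
  have hLtr : t⁻¹ * (trace B).re = (trace (S * (((t⁻¹ : ℝ) : ℂ) • 1) * Sᴴ)).re := by
    rw [← htr]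
    simp [-Complex.ofReal_inv]
  have := hK.re_trace_sub_trace_resolvent_le hL hKL
  rw [htr, htr, htr, hKt, hLt, hLtr]
  simp only [trace_sub, Complex.sub_re]
  linarith

open MeasureTheory Set in
theorem PosSemidef.re_trace_mul_cfc_rpow_add_le {B C : Matrix n n ℂ} (hB : B.PosSemidef)
    (hC : C.PosSemidef) {s : ℝ} (hs : 0 < s) (hs1 : s ≤ 1) :
    (trace (B * cfc (fun x : ℝ => x ^ s) (B + C))).re ≤
      (trace (B * cfc (fun x : ℝ => x ^ s) C)).re +
        (trace (B * cfc (fun x : ℝ => x ^ s) B)).re := by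
  obtain rfl | hs1 := hs1.eq_or_lt
  · simp only [Real.rpow_one]
    rw [cfc_id' ℝ _ (hB.add hC).isHermitian.isSelfAdjoint, cfc_id' ℝ _ hB.isHermitian.isSelfAdjoint,
      cfc_id' ℝ _ hC.isHermitian.isSelfAdjoint, mul_add, trace_add, Complex.add_re, add_comm]
  obtain ⟨μ, hμ⟩ := Real.exists_measure_rpow_eq_integral_rpowIntegrand₀₁ (p := s) ⟨hs, hs1⟩
  have key : ∀ {N : Matrix n n ℂ}, N.PosSemidef →
      IntegrableOn (fun t => (trace (B * cfc (Real.rpowIntegrand₀₁ s t) N)).re) (Ioi 0) μ ∧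
      (trace (B * cfc (fun x : ℝ => x ^ s) N)).re =
        ∫ t in Ioi 0, (trace (B * cfc (Real.rpowIntegrand₀₁ s t) N)).re ∂μ := fun {N} hN => by
    obtain ⟨w, hw⟩ := hN.isHermitian.exists_re_trace_mul_cfc_eq_sum B
    simp only [hw]
    have hint : ∀ j ∈ Finset.univ, IntegrableOn (fun t => Real.rpowIntegrand₀₁ s t
        (hN.isHermitian.eigenvalues j) * w j) (Ioi 0) μ := fun j _ =>
      (hμ _ (hN.eigenvalues_nonneg j)).1.mul_const _
    refine ⟨integrable_finsetSum _ hint, ?_⟩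
    rw [integral_finsetSum _ hint]
    refine Finset.sum_congr rfl fun j _ => ?_
    rw [integral_mul_const, ← (hμ _ (hN.eigenvalues_nonneg j)).2]
  have hlin : ∀ {N : Matrix n n ℂ}, N.PosSemidef → ∀ t : ℝ,
      (trace (B * cfc (Real.rpowIntegrand₀₁ s t) N)).re =
        t ^ s * (t⁻¹ * (trace B).re - (trace (B * cfc (fun x : ℝ => (t + x)⁻¹) N)).re) :=
    fun {N} hN t => by
    obtain ⟨w, hw⟩ := hN.isHermitian.exists_re_trace_mul_cfc_eq_sum B
    have h1 := hw 1
    rw [cfc_one ℝ N hN.isHermitian.isSelfAdjoint, mul_one] at h1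
    rw [hw, hw, h1, Finset.mul_sum, ← Finset.sum_sub_distrib, Finset.mul_sum]
    refine Finset.sum_congr rfl fun j _ => ?_
    simp only [Real.rpowIntegrand₀₁, Pi.one_apply]
    ring
  rw [(key (hB.add hC)).2, (key hC).2, (key hB).2, ← integral_add (key hC).1 (key hB).1]
  refine setIntegral_mono_on (key (hB.add hC)).1 ((key hC).1.add (key hB).1) measurableSet_Ioi
    fun t ht => ?_
  rw [hlin (hB.add hC), hlin hC, hlin hB, ← mul_add]
  have := hB.re_trace_mul_resolvent_sub_le hC (mem_Ioi.mp ht)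
  have ht' : 0 ≤ t ^ s := Real.rpow_nonneg (mem_Ioi.mp ht).le s
  exact mul_le_mul_of_nonneg_left (by linarith) ht'

/-- A form of Young's inequality for traces. -/
theorem PosSemidef.re_trace_mul_le_young {A W : Matrix n n ℂ} (hA : A.PosSemidef)
    (hW : W.PosSemidef) {p q : ℝ} (hpq : p.HolderConjugate q) :
    (trace (A * W)).re ≤ (trace (cfc (fun x : ℝ => x ^ p) A)).re / p +
      (trace (cfc (fun x : ℝ => x ^ q) W)).re / q := by
  have h := hA.isHermitian.sum_re_trace_cfc_mul_cfc_nonneg hW.isHermitian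
    ![1 / p, 1 / q, -1] ![fun x => x ^ p, 1, id] ![1, fun x => x ^ q, id] (by
      intro x hx y hy
      have := Real.young_inequality_of_nonneg (hA.nonneg_of_mem_spectrum hx)
        (hW.nonneg_of_mem_spectrum hy) hpq
      simp [Fin.sum_univ_succ]
      linarith [div_eq_inv_mul (x ^ p) p, div_eq_inv_mul (y ^ q) q])
  simp [Fin.sum_univ_succ, cfc_one ℝ A hA.isHermitian.isSelfAdjoint,
    cfc_one ℝ W hW.isHermitian.isSelfAdjoint, cfc_id ℝ A hA.isHermitian.isSelfAdjoint,
    cfc_id ℝ W hW.isHermitian.isSelfAdjoint] at h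
  rw [div_eq_inv_mul, div_eq_inv_mul]
  linarith

theorem PosSemidef.re_trace_mul_cfc_rpow_le {C W : Matrix n n ℂ} (hC : C.PosSemidef)
    (hW : W.PosSemidef) {s : ℝ} (hs : 0 < s) (hs1 : s ≤ 1) :
    (trace (C * cfc (fun x : ℝ => x ^ s) W)).re ≤
      (1 - s) * (trace (C * cfc (fun x : ℝ => x ^ s) C)).re +
        s * (trace (cfc (fun x : ℝ => x ^ s) C * W)).re := by
  have h := hC.isHermitian.sum_re_trace_cfc_mul_cfc_nonneg hW.isHermitian
    ![1 - s, s, -1] ![fun x => x * x ^ s, fun x => x ^ s, id] ![1, id, fun x => x ^ s] (by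
      intro x hx y hy
      replace hx := hC.nonneg_of_mem_spectrum hx
      replace hy := hW.nonneg_of_mem_spectrum hy
      have h1 := Real.geom_mean_le_arith_mean2_weighted (sub_nonneg.mpr hs1) hs.le hx hy (by ring)
      have h2 := mul_le_mul_of_nonneg_left h1 (Real.rpow_nonneg hx s)
      have h3 : x ^ s * x ^ (1 - s) = x := by
        rw [← Real.rpow_add' hx (by norm_num)]
        norm_num
      rw [← mul_assoc, h3] at h2
      simp [Fin.sum_univ_succ]
      linarith)
  have h3 : cfc (fun x : ℝ => x * x ^ s) C = C * cfc (fun x : ℝ => x ^ s) C := by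
    rw [← cfc_mul_cfc, cfc_id' ℝ C hC.isHermitian.isSelfAdjoint]
  simp [Fin.sum_univ_succ, cfc_one ℝ W hW.isHermitian.isSelfAdjoint,
    cfc_id ℝ C hC.isHermitian.isSelfAdjoint, cfc_id ℝ W hW.isHermitian.isSelfAdjoint, h3] at h
  linarith

/-- The trace of the `(1 + s)`-th power of a sum of two positive semidefinite matrices. -/
theorem PosSemidef.re_trace_add_mul_cfc_rpow_add_le {B C : Matrix n n ℂ} (hB : B.PosSemidef)
    (hC : C.PosSemidef) {s : ℝ} (hs : 0 < s) (hs1 : s ≤ 1) :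
    (trace ((B + C) * cfc (fun x : ℝ => x ^ s) (B + C))).re ≤
      (trace (B * cfc (fun x : ℝ => x ^ s) B)).re + (trace (C * cfc (fun x : ℝ => x ^ s) C)).re +
        (1 + s) * (trace (B * cfc (fun x : ℝ => x ^ s) C)).re := by
  have h1 := hB.re_trace_mul_cfc_rpow_add_le hC hs hs1
  have h2 := hC.re_trace_mul_cfc_rpow_le (hB.add hC) hs hs1
  rw [mul_add, trace_add, Complex.add_re, trace_mul_comm _ B, trace_mul_comm _ C] at h2
  rw [add_mul, trace_add, Complex.add_re]
  linarith

theorem cfc_diagonal_apply_of_ne {d : n → ℂ} (f : ℝ → ℝ) {i j : n} (hij : i ≠ j) :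
    cfc f (diagonal d) i j = 0 := by
  have h : Commute (diagonal d) (diagonal (Pi.single i (1 : ℂ))) := commute_diagonal _ _
  have h' := congrFun (congrFun (h.cfc_real f).eq i) j
  simpa [mul_diagonal, diagonal_mul, hij.symm] using h'.symm

theorem trace_mul_cfc_diagonal_eq_zero {X : Matrix n n ℂ} (hX : ∀ i, X i i = 0) (d : n → ℂ)
    (f : ℝ → ℝ) : trace (X * cfc f (diagonal d)) = 0 := by
  refine Finset.sum_eq_zero fun i _ => ?_
  rw [diag_apply, mul_apply]
  refine Finset.sum_eq_zero fun j _ => ?_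
  obtain rfl | hij := eq_or_ne j i
  · rw [hX, zero_mul]
  · rw [cfc_diagonal_apply_of_ne f hij, mul_zero]

/-- If `-X ≤ D`, the `p`-th power of the negative part of `X` has trace at most that of `D ^ p`. -/
theorem PosSemidef.re_trace_cfc_negPart_rpow_le {D X : Matrix n n ℂ} (hD : D.PosSemidef)
    (hX : X.IsHermitian) (hDX : (X + D).PosSemidef) {p : ℝ} (hp : 1 < p) :
    (trace (cfc (fun x : ℝ => (max (-x) 0) ^ p) X)).re ≤
      (trace (cfc (fun x : ℝ => x ^ p) D)).re := by
  set φ : ℝ → ℝ := fun x => (max (-x) 0) ^ (p - 1) with hφ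
  have hpq := Real.HolderConjugate.conjExponent hp
  have h := hX.sum_re_trace_cfc_mul_cfc_nonneg hD.isHermitian
    ![1, -1, -p, -p] ![1, fun x => (max (-x) 0) ^ p, φ, fun x => φ x * x]
    ![fun x => x ^ p, 1, id, 1] (by
      intro x _ y hy
      have h1 : (0 : ℝ) ≤ max (-x) 0 := le_max_right _ _
      have h2 := Real.young_inequality_of_nonneg (hD.nonneg_of_mem_spectrum hy)
        (Real.rpow_nonneg h1 (p - 1)) hpq
      rw [← Real.rpow_mul h1, hpq.sub_one_mul_conj] at h2
      have h3 : φ x * x = - (max (-x) 0) ^ p := by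
        have h4 : (max (-x) 0) ^ p = φ x * max (-x) 0 := by
          rw [hφ, ← Real.rpow_add_one' h1 (by linarith), sub_add_cancel]
        obtain hx | hx := le_total 0 x
        · have hφx : φ x = (max (-x) 0) ^ (p - 1) := rfl
          rw [h4, hφx, max_eq_right (by linarith : -x ≤ 0), Real.zero_rpow (sub_pos.mpr hp).ne']
          simp
        · rw [h4, max_eq_left (by linarith : 0 ≤ -x)]
          ring
      have h5 : p * (y * φ x) ≤ p * (y ^ p / p + (max (-x) 0) ^ p / p.conjExponent) :=
        mul_le_mul_of_nonneg_left h2 (by linarith)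
      have h6 : p * (y ^ p / p + (max (-x) 0) ^ p / p.conjExponent) =
          y ^ p + (p - 1) * (max (-x) 0) ^ p := by
        rw [← hpq.div_conj_eq_sub_one]
        field_simp
      rw [h6] at h5
      simp [Fin.sum_univ_succ, h3]
      linarith)
  have h3 : cfc (fun x => φ x * x) X = cfc φ X * X := by
    rw [← cfc_mul_cfc, cfc_id' ℝ X hX.isSelfAdjoint]
  have h4 : 0 ≤ (trace (cfc φ X * (X + D))).re :=
    (posSemidef_cfc_s14 fun x _ => Real.rpow_nonneg (le_max_right _ _) _).re_trace_mul_nonneg hDX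
  rw [mul_add, trace_add, Complex.add_re] at h4
  simp [Fin.sum_univ_succ, cfc_one ℝ X hX.isSelfAdjoint,
    cfc_one ℝ D hD.isHermitian.isSelfAdjoint, cfc_id ℝ D hD.isHermitian.isSelfAdjoint, h3] at h
  have h5 := mul_nonneg (by linarith : (0 : ℝ) ≤ p) h4
  linarith

theorem PosSemidef.re_trace_cfc_posPart_rpow_add_le {A : Matrix n n ℂ} (hA : A.PosSemidef) {p : ℝ}
    (hp : 2 ≤ p) :
    (trace (cfc (fun x : ℝ => (max x 0) ^ p) (A - diagonal fun i => A i i))).re +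
        (trace (cfc (fun x : ℝ => x ^ p) (diagonal fun i => A i i))).re ≤
      (trace (cfc (fun x : ℝ => x ^ p) A)).re := by
  have hD : (diagonal fun i => A i i).PosSemidef := PosSemidef.diagonal fun i => hA.diag_nonneg
  have hX : (A - diagonal fun i => A i i).IsHermitian := hA.isHermitian.sub hD.isHermitian
  have hX0 : ∀ i, (A - diagonal fun i => A i i) i i = 0 := fun i => by simp
  have hXC := trace_mul_cfc_diagonal_eq_zero hX0 (fun i => A i i) fun x : ℝ => x ^ (p - 1)
  have hAXD : A = (A - diagonal fun i => A i i) + diagonal fun i => A i i := by simp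
  set D := diagonal fun i => A i i
  set X := A - D
  have hpq := Real.HolderConjugate.conjExponent (by linarith : 1 < p)
  set q := p.conjExponent
  have hps : (p - 1) * (q - 1) = 1 := by linarith [hpq.sub_one_mul_conj]
  have hs : 0 < q - 1 := sub_pos.mpr hpq.symm.lt
  have hs1 : q - 1 ≤ 1 := by nlinarith
  set B := cfc (fun x : ℝ => (max x 0) ^ (p - 1)) X with hBdef
  set C := cfc (fun x : ℝ => x ^ (p - 1)) D with hCdef
  have hm : ∀ x : ℝ, 0 ≤ max x 0 := fun x => le_max_right _ _
  have hB : B.PosSemidef := posSemidef_cfc_s14 fun x _ => Real.rpow_nonneg (hm x) _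
  have hC : C.PosSemidef := posSemidef_cfc_s14 fun x hx =>
    Real.rpow_nonneg (hD.nonneg_of_mem_spectrum hx) _
  have hCD : cfc (fun x : ℝ => x ^ (q - 1)) C = D := by
    rw [hCdef, hD.isHermitian.cfc_cfc]
    conv_rhs => rw [← cfc_id' ℝ D hD.isHermitian.isSelfAdjoint]
    refine cfc_congr fun x hx => ?_
    rw [← Real.rpow_mul (hD.nonneg_of_mem_spectrum hx), hps, Real.rpow_one]
  have hCDp : C * D = cfc (fun x : ℝ => x ^ p) D := by
    have : C * D = C * cfc (fun x : ℝ => x) D := by rw [cfc_id' ℝ D hD.isHermitian.isSelfAdjoint]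
    rw [this, hCdef, cfc_mul_cfc]
    refine cfc_congr fun x hx => ?_
    rw [← Real.rpow_add_one' (hD.nonneg_of_mem_spectrum hx) (by linarith), sub_add_cancel]
  have hXB : X * B = cfc (fun x : ℝ => (max x 0) ^ p) X := by
    have : X * B = cfc (fun x : ℝ => x) X * B := by rw [cfc_id' ℝ X hX.isSelfAdjoint]
    rw [this, cfc_mul_cfc]
    refine cfc_congr fun x _ => ?_
    obtain hx | hx := le_total 0 x
    · rw [max_eq_left hx, ← Real.rpow_one_add' hx (by linarith), add_sub_cancel]
    · rw [max_eq_right hx, Real.zero_rpow (by linarith), Real.zero_rpow (by linarith), mul_zero]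
  have hBB : B * cfc (fun x : ℝ => x ^ (q - 1)) B = cfc (fun x : ℝ => (max x 0) ^ p) X := by
    rw [hBdef, hX.cfc_cfc, cfc_mul_cfc]
    refine cfc_congr fun x hx => ?_
    rw [← Real.rpow_mul (hm x), hps, ← Real.rpow_add' (hm x) (by linarith), sub_add_cancel]
  have hW := hB.add hC
  have hWW : (B + C) * cfc (fun x : ℝ => x ^ (q - 1)) (B + C) =
      cfc (fun x : ℝ => x ^ q) (B + C) := by
    have : (B + C) * cfc (fun x : ℝ => x ^ (q - 1)) (B + C) =
        cfc (fun x : ℝ => x) (B + C) * cfc (fun x : ℝ => x ^ (q - 1)) (B + C) := by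
      rw [cfc_id' ℝ (B + C) hW.isHermitian.isSelfAdjoint]
    rw [this, cfc_mul_cfc]
    refine cfc_congr fun x hx => ?_
    rw [← Real.rpow_one_add' (hW.nonneg_of_mem_spectrum hx) (by linarith), add_sub_cancel]
  have h1 := hA.re_trace_mul_le_young hW hpq
  have h2 := hB.re_trace_add_mul_cfc_rpow_add_le hC hs hs1
  rw [hWW, hBB, hCD, hCDp] at h2
  have h3 : (trace (A * (B + C))).re = (trace (cfc (fun x : ℝ => (max x 0) ^ p) X)).re +
      (trace (B * D)).re + (trace (cfc (fun x : ℝ => x ^ p) D)).re := by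
    conv_lhs => rw [hAXD]
    rw [mul_add, add_mul, add_mul, hXB, trace_mul_comm B, trace_add, trace_add, trace_add, hXC,
      trace_mul_comm D C, hCDp]
    simp
  have h4 := mul_le_mul_of_nonneg_left h1 (by linarith : (0 : ℝ) ≤ p)
  have h5 := mul_le_mul_of_nonneg_left h2 (by linarith : (0 : ℝ) ≤ p - 1)
  have h6 (a w : ℝ) : p * (a / p + w / q) = a + (p - 1) * w := by
    rw [← hpq.div_conj_eq_sub_one]
    field_simp [hpq.ne_zero, hpq.symm.ne_zero]
  rw [h3, h6] at h4
  have h7 : (p - 1) * (1 + (q - 1)) = p := by linarith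
  rw [mul_add, ← mul_assoc, h7] at h5
  linarith

/-- Removing the diagonal of a positive semidefinite matrix does not increase its Schatten
`p`-norm when `2 ≤ p`. -/
theorem PosSemidef.re_trace_cfc_abs_rpow_sub_diagonal_le {A : Matrix n n ℂ} (hA : A.PosSemidef)
    {p : ℝ} (hp : 2 ≤ p) :
    (trace (cfc (fun x : ℝ => |x| ^ p) (A - diagonal fun i => A i i))).re ≤
      (trace (cfc (fun x : ℝ => x ^ p) A)).re := by
  have hD : (diagonal fun i => A i i).PosSemidef := PosSemidef.diagonal fun i => hA.diag_nonneg
  have hX : (A - diagonal fun i => A i i).IsHermitian := hA.isHermitian.sub hD.isHermitian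
  have h1 := hA.re_trace_cfc_posPart_rpow_add_le hp
  have h2 := hD.re_trace_cfc_negPart_rpow_le hX (by simpa using hA) (by linarith : 1 < p)
  have h3 : (fun x : ℝ => |x| ^ p) = fun x : ℝ => (max x 0) ^ p + (max (-x) 0) ^ p := by
    have hp0 : p ≠ 0 := by linarith
    ext x
    obtain hx | hx := le_total 0 x
    · rw [abs_of_nonneg hx, max_eq_left hx, max_eq_right (by linarith), Real.zero_rpow hp0,
        add_zero]
    · rw [abs_of_nonpos hx, max_eq_right hx, max_eq_left (by linarith), Real.zero_rpow hp0,
        zero_add]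
  rw [h3, cfc_add _ _ _ (continuousOn_spectrum_real_s14 _ _) (continuousOn_spectrum_real_s14 _ _),
    trace_add, Complex.add_re]
  linarith

end Matrix

/-- For `n ≥ 1`, a positive semidefinite `n × n` complex matrix `A`, the diagonal
matrix `D` of its diagonal entries and a real `p ≥ 2`,
`Re (trace |A - D|^p) ≤ Re (trace (A^p))`; the powers are given by the continuous
functional calculus. -/
theorem stmt_14 (n : ℕ) (hn : 1 ≤ n) (A : Matrix (Fin n) (Fin n) ℂ)
    (hA : A.PosSemidef) (p : ℝ) (hp : 2 ≤ p) :
    (Matrix.trace (cfc (fun t : ℝ => |t| ^ p) (A - Matrix.diagonal fun i => A i i))).re ≤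
      (Matrix.trace (cfc (fun t : ℝ => t ^ p) A)).re := by
  exact hA.re_trace_cfc_abs_rpow_sub_diagonal_le hp
end

section
/- Let n ≥ 1 and let p ≥ 1 be a real number. The map from the real vector space of Hermitian n×n complex matrices to itself sending X to the matrix obtained by applying the continuous functional calculus with t ↦ |t|^p to X is Fréchet differentiable at every positive definite matrix X. -/
open ComplexOrder

open Filter Topology

/-- The radius of convergence of a scalar power series does not decrease when it is evaluated in a
normed algebra. -/
theorem FormalMultilinearSeries.radius_ofScalars_le (E : Type*) [NormedRing E]
    [NormedAlgebra ℝ E] (c : ℕ → ℝ) :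
    (FormalMultilinearSeries.ofScalars ℝ c).radius ≤
      (FormalMultilinearSeries.ofScalars E c).radius := by
  refine ENNReal.le_of_forall_nnreal_lt fun r hr => ?_
  obtain ⟨C, -, hC⟩ := (FormalMultilinearSeries.ofScalars ℝ c).norm_mul_pow_le_of_lt_radius hr
  refine FormalMultilinearSeries.le_radius_of_eventually_le _ C ?_
  filter_upwards [eventually_gt_atTop 0] with n hn
  refine le_trans ?_ (hC n)
  rw [FormalMultilinearSeries.ofScalars_norm ℝ]
  gcongr
  exact FormalMultilinearSeries.ofScalars_norm_le E c n hn

section FunctionalCalculus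

variable {A : Type*} [NormedRing A] [StarRing A] [NormedAlgebra ℝ A] [CompleteSpace A]
  [IsometricContinuousFunctionalCalculus ℝ A IsSelfAdjoint]

/-- The continuous functional calculus of a real function given by a power series is the sum of
the same series in the algebra. -/
theorem cfc_eq_sum_ofScalars {f : ℝ → ℝ} {c : ℕ → ℝ} {r : ENNReal}
    (hf : HasFPowerSeriesOnBall f (FormalMultilinearSeries.ofScalars ℝ c) 0 r) {a : A}
    (ha : IsSelfAdjoint a) (har : a ∈ Metric.eball (0 : A) r) :
    cfc f a = (FormalMultilinearSeries.ofScalars A c).sum a := by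
  set q := FormalMultilinearSeries.ofScalars A c with hq
  have hrad : r ≤ q.radius :=
    hf.r_le.trans (FormalMultilinearSeries.radius_ofScalars_le A c)
  have hlim : Tendsto (fun n => q.partialSum n a) atTop (𝓝 (q.sum a)) :=
    (q.hasSum (Metric.eball_subset_eball hrad har)).tendsto_sum_nat
  obtain ⟨s, has, hsr⟩ : ∃ s : NNReal, ‖a‖₊ < s ∧ (s : ENNReal) < r := by
    simp only [Metric.mem_eball, edist_zero_right] at har
    simpa [enorm] using ENNReal.lt_iff_exists_nnreal_btwn.1 har
  have hunif : TendstoUniformlyOn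
      (fun n t => (FormalMultilinearSeries.ofScalars ℝ c).partialSum n t) f atTop
      (spectrum ℝ a) := by
    refine (by simpa using hf.tendstoUniformlyOn hsr : TendstoUniformlyOn _ f atTop _).mono ?_
    intro t ht
    rw [mem_ball_zero_iff]
    exact (IsometricContinuousFunctionalCalculus.norm_spectrum_le a ht ha).trans_lt has
  refine tendsto_nhds_unique ?_ hlim
  refine (tendsto_cfc_fun hunif (.of_forall fun n =>
    (FormalMultilinearSeries.partialSum_continuous _ n).continuousOn)).congr fun n => ?_
  have hsum : (fun t : ℝ => (FormalMultilinearSeries.ofScalars ℝ c).partialSum n t) =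
      ∑ k ∈ Finset.range n, fun t : ℝ => c k • t ^ k := by
    ext t
    simp [FormalMultilinearSeries.partialSum, mul_comm]
  rw [hsum, cfc_sum _ _ _ (fun k _ => by fun_prop)]
  simp only [FormalMultilinearSeries.partialSum, hq, FormalMultilinearSeries.ofScalars_apply_eq]
  refine Finset.sum_congr rfl fun k _ => ?_
  rw [cfc_smul _ _ _ (by fun_prop), cfc_pow_id a k]

/-- The functional calculus of `t ↦ |t| ^ p` is differentiable, relative to the selfadjoint
elements, at every selfadjoint element with positive spectrum. -/
theorem differentiableWithinAt_cfc_abs_rpow (p : ℝ) {a : A}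
    (ha : IsSelfAdjoint a) (hpos : ∀ t ∈ spectrum ℝ a, 0 < t) :
    DifferentiableWithinAt ℝ (fun b : A => cfc (fun t : ℝ => |t| ^ p) b)
      {b : A | IsSelfAdjoint b} a := by
  set c : ℝ := ‖a‖ + 1 with hc
  have hc0 : 0 < c := by positivity
  set u : A → A := fun b => c⁻¹ • b - 1 with hu
  have hu_cfc : ∀ b : A, IsSelfAdjoint b → cfc (fun t : ℝ => c⁻¹ * t - 1) b = u b := by
    intro b hb
    rw [cfc_sub (fun t : ℝ => c⁻¹ * t) (fun _ => 1) b, cfc_const_mul_id c⁻¹ b, cfc_const_one ℝ b]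
  have hu_diff : Differentiable ℝ u := (differentiable_id.const_smul c⁻¹).sub_const 1
  have hua : ‖u a‖ < 1 := by
    rw [← hu_cfc a ha]
    refine norm_cfc_lt one_pos fun t ht => ?_
    have hta : t ≤ ‖a‖ :=
      (le_abs_self t).trans (IsometricContinuousFunctionalCalculus.norm_spectrum_le a ht ha)
    have h0 : 0 < c⁻¹ * t := mul_pos (inv_pos.2 hc0) (hpos t ht)
    have h1 : c⁻¹ * t < 1 := by
      rw [inv_mul_lt_iff₀ hc0]
      linarith
    rw [Real.norm_eq_abs, abs_lt]
    constructor <;> linarith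
  have hball : ∀ b : A, ‖u b‖ < 1 → u b ∈ Metric.eball (0 : A) 1 := fun b hb => by
    rw [← ENNReal.ofReal_one, Metric.eball_ofReal]
    simpa using hb
  set q := FormalMultilinearSeries.ofScalars A (fun k => Ring.choose p k) with hq
  have hbin : HasFPowerSeriesOnBall (fun x : ℝ => (1 + x) ^ p)
      (FormalMultilinearSeries.ofScalars ℝ (fun k => Ring.choose p k)) 0 1 :=
    Real.one_add_rpow_hasFPowerSeriesOnBall_zero
  have hrad : 1 ≤ q.radius :=
    hbin.r_le.trans (FormalMultilinearSeries.radius_ofScalars_le A _)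
  have heq : ∀ b : A, IsSelfAdjoint b → ‖u b‖ < 1 →
      cfc (fun t : ℝ => |t| ^ p) b = c ^ p • q.sum (u b) := by
    intro b hb hub
    have hlt : ∀ t ∈ spectrum ℝ b, 0 < t := by
      intro t ht
      have h := (norm_cfc_lt_iff (fun t : ℝ => c⁻¹ * t - 1) b one_pos).1
        (by rwa [hu_cfc b hb]) t ht
      rw [Real.norm_eq_abs, abs_lt] at h
      exact pos_of_mul_pos_right (by linarith : 0 < c⁻¹ * t) (inv_nonneg.2 hc0.le)
    have hcont : ContinuousOn (fun x : ℝ => (1 + x) ^ p)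
        ((fun t : ℝ => c⁻¹ * t - 1) '' spectrum ℝ b) := by
      refine ContinuousOn.rpow_const (by fun_prop) ?_
      rintro _ ⟨t, ht, rfl⟩
      have := mul_pos (inv_pos.2 hc0) (hlt t ht)
      exact .inl (by simpa using this.ne')
    have hub_sa : IsSelfAdjoint (u b) := by
      rw [← hu_cfc b hb]
      exact cfc_predicate _ b
    rw [← cfc_eq_sum_ofScalars hbin hub_sa (hball b hub), ← hu_cfc b hb,
      ← cfc_comp' (fun x : ℝ => (1 + x) ^ p) (fun t : ℝ => c⁻¹ * t - 1) b hcont,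
      ← cfc_smul (c ^ p) (fun t : ℝ => (1 + (c⁻¹ * t - 1)) ^ p) b
        (hcont.comp (by fun_prop) (Set.mapsTo_image _ _))]
    refine cfc_congr fun t ht => ?_
    have ht0 := hlt t ht
    have h1 : 1 + (c⁻¹ * t - 1) = c⁻¹ * t := by ring
    simp only [smul_eq_mul]
    rw [h1, abs_of_pos ht0, ← Real.mul_rpow hc0.le (by positivity), mul_inv_cancel_left₀ hc0.ne']
  have hsum : DifferentiableAt ℝ q.sum (u a) :=
    (((q.hasFPowerSeriesOnBall (one_pos.trans_le hrad)).mono one_pos hrad).differentiableOn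
      _ (hball a hua)).differentiableAt (Metric.isOpen_eball.mem_nhds (hball a hua))
  have hmain : DifferentiableAt ℝ (fun b => c ^ p • q.sum (u b)) a :=
    (hsum.comp a (hu_diff a)).const_smul (c ^ p)
  refine hmain.differentiableWithinAt.congr_of_eventuallyEq ?_ (heq a ha hua)
  have hnhds : ∀ᶠ b in 𝓝 a, ‖u b‖ < 1 :=
    hu_diff.continuous.norm.continuousAt.eventually_lt continuousAt_const hua
  filter_upwards [self_mem_nhdsWithin, nhdsWithin_le_nhds hnhds] with b hb hub
  exact heq b hb hub

end FunctionalCalculus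

open scoped Matrix.Norms.L2Operator in
/-- The functional calculus of `t ↦ |t| ^ p` is differentiable, relative to the Hermitian
matrices, at every positive definite matrix. -/
theorem Matrix.PosDef.differentiableWithinAt_cfc_abs_rpow {n : Type*} [Fintype n] [DecidableEq n]
    (p : ℝ) {X : Matrix n n ℂ} (hX : X.PosDef) :
    DifferentiableWithinAt ℝ (fun Y : Matrix n n ℂ => cfc (fun t : ℝ => |t| ^ p) Y)
      {Y : Matrix n n ℂ | IsSelfAdjoint Y} X := by
  refine _root_.differentiableWithinAt_cfc_abs_rpow p hX.isHermitian fun t ht => ?_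
  rw [hX.isHermitian.spectrum_real_eq_range_eigenvalues] at ht
  obtain ⟨i, rfl⟩ := ht
  exact hX.eigenvalues_pos i

attribute [local instance] Matrix.normedAddCommGroup Matrix.normedSpace

/-- For `n ≥ 1` and a real `p ≥ 1`, the map sending a Hermitian matrix `X` to
`cfc (fun t => |t| ^ p) X` (the functional calculus of `t ↦ |t|^p`) is Fréchet
differentiable at every positive definite matrix `X`.  The real vector space of
Hermitian `n × n` complex matrices is realized as the subset
`{X | IsSelfAdjoint X}` of the (normed) space of all `n × n` complex matrices, and
Fréchet differentiability of the map on this subspace at `X` is expressed as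
`DifferentiableWithinAt ℝ` on this set. -/
theorem stmt_15 (n : ℕ) (hn : 1 ≤ n) (p : ℝ) (hp : 1 ≤ p)
    (X : Matrix (Fin n) (Fin n) ℂ) (hX : X.PosDef) :
    DifferentiableWithinAt ℝ (fun Y : Matrix (Fin n) (Fin n) ℂ => cfc (fun t : ℝ => |t| ^ p) Y)
      {Y : Matrix (Fin n) (Fin n) ℂ | IsSelfAdjoint Y} X := by
  exact hX.differentiableWithinAt_cfc_abs_rpow p
end

section
/- For every real number p with 1 < p < 2, there exists a real number w with 0 < w < 1 such that w (1 − w)^p + (1 − w) w^p > w. -/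
/-- For every real `p` with `1 < p < 2` there is `0 < w < 1` with
`w * (1 - w) ^ p + (1 - w) * w ^ p > w`, where powers are real powers. -/
theorem stmt_17 (p : ℝ) (hp1 : 1 < p) (hp2 : p < 2) :
    ∃ w : ℝ, 0 < w ∧ w < 1 ∧ w * (1 - w) ^ p + (1 - w) * w ^ p > w := by
  have hq : 0 < 2 - p := by linarith
  obtain ⟨w, hw0, hw⟩ : ∃ w : ℝ, 0 < w ∧ w ^ (2 - p) = 1 / 4 :=
    ⟨(1 / 4) ^ (2 - p)⁻¹, by positivity, Real.rpow_inv_rpow (by norm_num) hq.ne'⟩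
  have hw1 : w < 1 := by
    by_contra! h
    linarith [Real.one_le_rpow h hq.le]
  have hw4 : w ≤ 1 / 4 := by
    rw [← hw]
    exact Real.self_le_rpow_of_le_one hw0.le hw1.le (by linarith)
  have hwp : w ^ p = 4 * w ^ 2 := by
    have h : w ^ p * w ^ (2 - p) = w ^ 2 := by
      rw [← Real.rpow_add hw0, add_sub_cancel, Real.rpow_two]
    rw [hw] at h
    linarith
  have bernoulli : 1 - p * w ≤ (1 - w) ^ p := by
    have h := one_add_mul_self_le_rpow_one_add (s := -w) (by linarith) hp1.le
    rwa [mul_neg, ← sub_eq_add_neg, ← sub_eq_add_neg] at h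
  refine ⟨w, hw0, hw1, ?_⟩
  calc w < w + w ^ 2 * (4 * (1 - w) - p) :=
        lt_add_of_pos_right _ (mul_pos (by positivity) (by linarith))
    _ = w * (1 - p * w) + (1 - w) * w ^ p := by rw [hwp]; ring
    _ ≤ w * (1 - w) ^ p + (1 - w) * w ^ p := by gcongr
end

section
/- Let n ≥ 1, let B and Δ be positive definite n×n complex matrices, and let t > 0 be a real number. Then Re(trace(Δ * (Δ + t² (B + Δ + t I)⁻¹ − t² (B + t I)⁻¹))) ≥ Re(trace(Δ * Δ * Δ * (Δ + t I)⁻¹)). -/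
open ComplexOrder

open scoped Matrix MatrixOrder in
/-- The trace of a product of two positive semidefinite matrices is nonnegative. -/
theorem Matrix.PosSemidef.trace_mul_nonneg_of_posSemidef {m : Type*} [Fintype m]
    {P Q : Matrix m m ℂ} (hP : P.PosSemidef) (hQ : Q.PosSemidef) : 0 ≤ (P * Q).trace := by
  classical
  obtain ⟨X, rfl⟩ : ∃ X : Matrix m m ℂ, P = Xᴴ * X :=
    CStarAlgebra.nonneg_iff_eq_star_mul_self.mp hP.nonneg
  rw [Matrix.mul_assoc, Matrix.trace_mul_comm]
  exact (hQ.mul_mul_conjTranspose_same X).trace_nonneg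

/-- Second-order resolvent expansion of the inverse of `F` around `F + B`. -/
theorem resolvent_second_order {A : Type*} [Ring A] {F B e f : A}
    (heE : e * (F + B) = 1) (hEe : (F + B) * e = 1) (hfF : f * F = 1) (hFf : F * f = 1) :
    f - e = e * B * e + e * B * f * B * e := by
  have h1 : f - e = f * B * e := by
    calc f - e = f * ((F + B) * e) - f * F * e := by rw [hEe, hfF]; simp
      _ = f * B * e := by noncomm_ring
  have h2 : f - e = e * B * f := by
    calc f - e = e * (F + B) * f - e * (F * f) := by rw [heE, hFf]; simp
      _ = e * B * f := by noncomm_ring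
  calc f - e = e * B * f := h2
    _ = e * B * (e + (f - e)) := by rw [add_sub_cancel]
    _ = e * B * e + e * B * f * B * e := by rw [h1]; noncomm_ring

/-- With `e = (C + D)⁻¹`, the difference `D - C e D e C` is a congruence of `2 C + D`. -/
theorem sub_mul_inv_add_conj {A : Type*} [Ring A] {C D e : A}
    (heE : e * (C + D) = 1) (hEe : (C + D) * e = 1) :
    D - C * (e * D * e) * C = D * e * (C + C + D) * (e * D) := by
  have h1 : C * e = 1 - D * e := by rw [← hEe]; noncomm_ring
  have h2 : e * C = 1 - e * D := by rw [← heE]; noncomm_ring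
  have h3 : C + C + D = (C + D) + (C + D) - D := by abel
  calc D - C * (e * D * e) * C = D - (C * e) * D * (e * C) := by noncomm_ring
    _ = D * e * D + D * e * D - D * e * D * (e * D) := by rw [h1, h2]; noncomm_ring
    _ = D * (e * (C + D)) * (e * D) + D * (e * (C + D)) * (e * D) - D * e * D * (e * D) := by
        rw [heE]; noncomm_ring
    _ = D * e * (C + C + D) * (e * D) := by rw [h3]; noncomm_ring

/-- For `n ≥ 1`, positive definite `n × n` complex matrices `B` and `Δ` and a real
`t > 0`, `Re (trace (Δ * (Δ + t² (B + Δ + t I)⁻¹ - t² (B + t I)⁻¹))) ≥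
Re (trace (Δ * Δ * Δ * (Δ + t I)⁻¹))`, where `⁻¹` is the matrix inverse. -/
theorem stmt_18 (n : ℕ) (hn : 1 ≤ n) (B Δ : Matrix (Fin n) (Fin n) ℂ)
    (hB : B.PosDef) (hΔ : Δ.PosDef) (t : ℝ) (ht : 0 < t) :
    (Matrix.trace (Δ * (Δ + ((t : ℂ) ^ 2) • (B + Δ + (t : ℂ) • 1)⁻¹
        - ((t : ℂ) ^ 2) • (B + (t : ℂ) • 1)⁻¹))).re ≥
      (Matrix.trace (Δ * Δ * Δ * (Δ + (t : ℂ) • 1)⁻¹)).re := by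
  have hτ : (0 : ℂ) < (t : ℂ) := by exact_mod_cast ht
  generalize (t : ℂ) = τ at hτ ⊢
  have hI : (τ • (1 : Matrix (Fin n) (Fin n) ℂ)).PosDef := Matrix.PosDef.one.smul hτ
  have hC := hB.add hI
  have hF := hΔ.add hI
  have hE := (hB.add hΔ).add hI
  have hCc := Matrix.mul_nonsing_inv _ ((Matrix.isUnit_iff_isUnit_det _).mp hC.isUnit)
  have hcC := Matrix.nonsing_inv_mul _ ((Matrix.isUnit_iff_isUnit_det _).mp hC.isUnit)
  have hFf := Matrix.mul_nonsing_inv _ ((Matrix.isUnit_iff_isUnit_det _).mp hF.isUnit)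
  have hfF := Matrix.nonsing_inv_mul _ ((Matrix.isUnit_iff_isUnit_det _).mp hF.isUnit)
  have hEe := Matrix.mul_nonsing_inv _ ((Matrix.isUnit_iff_isUnit_det _).mp hE.isUnit)
  have heE := Matrix.nonsing_inv_mul _ ((Matrix.isUnit_iff_isUnit_det _).mp hE.isUnit)
  have hch := hC.inv.isHermitian
  have hfh := hF.inv.isHermitian
  have heh := hE.inv.isHermitian
  generalize (B + τ • (1 : Matrix (Fin n) (Fin n) ℂ))⁻¹ = c at *
  generalize (Δ + τ • (1 : Matrix (Fin n) (Fin n) ℂ))⁻¹ = f at *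
  generalize (B + Δ + τ • (1 : Matrix (Fin n) (Fin n) ℂ))⁻¹ = e at *
  have hEC : B + Δ + τ • (1 : Matrix (Fin n) (Fin n) ℂ) = (B + τ • 1) + Δ := by abel
  have hEF : B + Δ + τ • (1 : Matrix (Fin n) (Fin n) ℂ) = (Δ + τ • 1) + B := by abel
  have hres := resolvent_second_order (hEF ▸ heE) (hEF ▸ hEe) hfF hFf
  have hQ := sub_mul_inv_add_conj (hEC ▸ heE) (hEC ▸ hEe)
  have hp : (c * B).PosSemidef := by
    have h : c * B = c * (B * B + τ • B) * c.conjTranspose := by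
      calc c * B = c * B * ((B + τ • 1) * c) := by rw [hCc, mul_one]
        _ = c * (B * B + τ • B) * c.conjTranspose := by
          rw [hch.eq]; simp only [mul_add, add_mul, mul_smul_comm, smul_mul_assoc, one_mul,
            mul_assoc]
    rw [h]
    refine Matrix.PosSemidef.mul_mul_conjTranspose_same (.add ?_ (hB.posSemidef.smul hτ.le)) _
    simpa [pow_two] using hB.posSemidef.pow 2
  have hR : (Δ * f).PosSemidef := by
    have h : Δ * f = f * (Δ * Δ + τ • Δ) * f.conjTranspose := by
      calc Δ * f = f * (Δ + τ • 1) * Δ * f := by rw [hfF, one_mul]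
        _ = f * (Δ * Δ + τ • Δ) * f.conjTranspose := by
          rw [hfh.eq]; simp only [mul_add, add_mul, mul_smul_comm, smul_mul_assoc, mul_one,
            mul_assoc]
    rw [h]
    refine Matrix.PosSemidef.mul_mul_conjTranspose_same (.add ?_ (hΔ.posSemidef.smul hτ.le)) _
    simpa [pow_two] using hΔ.posSemidef.pow 2
  have hQpos : (Δ - (B + τ • 1) * (e * Δ * e) * (B + τ • 1)).PosSemidef := by
    rw [hQ]
    have := ((hC.add hC).add hΔ).posSemidef.mul_mul_conjTranspose_same (Δ * e)
    rwa [Matrix.conjTranspose_mul, heh.eq, hΔ.isHermitian.eq] at this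
  have hWR : (e * B * (Δ * f) * (B * e)).PosSemidef := by
    have := hR.mul_mul_conjTranspose_same (e * B)
    rwa [Matrix.conjTranspose_mul, heh.eq, hB.isHermitian.eq] at this
  have h1 := mul_nonneg hτ.le (hp.trace_mul_nonneg_of_posSemidef hQpos)
  have h2 := hΔ.posSemidef.trace_mul_nonneg_of_posSemidef hWR
  have hΔf : Δ * f = 1 - τ • f := by
    rw [← hFf, add_mul, smul_mul_assoc, one_mul, add_sub_cancel_right]
  have hBc : τ • c = 1 - c * B := by
    rw [← hcC, mul_add, mul_smul_comm, mul_one, add_sub_cancel_left]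
  have hcyc : (c * B * ((B + τ • 1) * (e * Δ * e) * (B + τ • 1))).trace
      = (Δ * (e * B * (B + τ • 1) * e)).trace := by
    calc _ = ((c * B * (B + τ • 1) * (e * Δ * e)) * (B + τ • 1)).trace := by
          simp only [mul_assoc]
      _ = ((B + τ • 1) * c * (B * (B + τ • 1) * e) * (Δ * e)).trace := by
          rw [Matrix.trace_mul_comm]; simp only [mul_assoc]
      _ = _ := by rw [hCc, one_mul, Matrix.trace_mul_comm]; simp only [mul_assoc]
  have hw : Δ * (e * B * (Δ * f) * (B * e))
      = Δ * (e * B * (B + τ • 1) * e) - τ • (Δ * (f - e)) := by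
    rw [hres, hΔf]
    simp only [mul_add, add_mul, mul_sub, sub_mul, mul_smul_comm, smul_mul_assoc, mul_one,
      mul_assoc, smul_add]
    abel
  have key : Matrix.trace (Δ * (Δ + (τ ^ 2) • e - (τ ^ 2) • c)) - Matrix.trace (Δ * Δ * Δ * f)
      = τ * (c * B * (Δ - (B + τ • 1) * (e * Δ * e) * (B + τ • 1))).trace
        + τ * (Δ * (e * B * (Δ * f) * (B * e))).trace := by
    have hl : Δ * Δ * Δ * f = Δ * Δ - τ • Δ + τ ^ 2 • (Δ * f) := by
      calc Δ * Δ * Δ * f = Δ * Δ * (Δ * f) := by simp only [mul_assoc]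
        _ = Δ * Δ - τ • (Δ * (Δ * f)) := by
          nth_rw 1 [hΔf]; rw [mul_sub, mul_one, mul_smul_comm, mul_assoc]
        _ = Δ * Δ - τ • Δ + τ ^ 2 • (Δ * f) := by
          nth_rw 1 [hΔf]; rw [mul_sub, mul_one, mul_smul_comm, smul_sub, smul_smul]
          rw [pow_two]; abel
    have hc2 : τ ^ 2 • c = τ • (1 - c * B) := by rw [← hBc, smul_smul, pow_two]
    rw [hl, hc2, hw, mul_sub (c * B), Matrix.trace_sub (c * B * Δ), hcyc,
      Matrix.trace_mul_comm (c * B) Δ]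
    simp only [mul_add, mul_sub, mul_smul_comm, Matrix.trace_add, Matrix.trace_sub,
      Matrix.trace_smul, smul_eq_mul, mul_one]
    ring
  have h3 := add_nonneg h1 (mul_nonneg hτ.le h2)
  rw [← key] at h3
  exact (Complex.le_def.mp (sub_nonneg.mp h3)).1
end
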